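/- arXiv:1708.05338 — 2 statements merged into one kernel-verified Lean document; each statement's English description precedes it below -/
import Mathlib

section
/- For every ε > 0 and every n ∈ ℕ₊ there exists δ > 0 such that for all d ∈ ℕ₊ the following holds: if A₁, A₂, …, Aₙ are d×d complex matrices, each of which is either unitary or self-adjoint, and for all 1 ≤ i, j ≤ n we have rank(AᵢAⱼ − AⱼAᵢ) ≤ δ, then there exist pairwise commuting d×d complex matrices B₁, …, Bₙ such that rank(Aᵢ − Bᵢ) ≤ ε for every 1 ≤ i ≤ n. -/
open Matrix

/-- The normalized rank of a square matrix: `dim_ℂ(im A) / d`. -/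
noncomputable def nrank {d : ℕ} (A : Matrix (Fin d) (Fin d) ℂ) : ℝ :=
  (A.rank : ℝ) / d


section UP
open MvPolynomial
open Filter hiding map

lemma germ_isAlgClosed (U : Ultrafilter ℕ) : IsAlgClosed (Germ (U : Filter ℕ) ℂ) := by
  refine IsAlgClosed.of_exists_root _ fun p hp hirr => ?_
  have hsurj : Function.Surjective (Germ.coeRingHom (R := ℂ) (U : Filter ℕ)) := by
    intro x
    induction x using Germ.inductionOn with
    | _ f => exact ⟨f, rfl⟩
  obtain ⟨P, hP, hdeg, hmon⟩ := Polynomial.lifts_and_natDegree_eq_and_monic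
    (Polynomial.mem_lifts_of_surjective hsurj p) hp
  have hroot : ∀ r : ℕ, ∃ z : ℂ, (P.map (Pi.evalRingHom (fun _ => ℂ) r)).eval z = 0 := by
    intro r
    refine IsAlgClosed.exists_root _ ?_
    rw [Polynomial.degree_eq_natDegree (hmon.map _).ne_zero, hmon.natDegree_map, hdeg]
    have := hirr.natDegree_pos
    exact_mod_cast this.ne'
  choose z hz using hroot
  refine ⟨Germ.coeRingHom (U : Filter ℕ) z, ?_⟩
  rw [← hP, Polynomial.eval_map, Polynomial.eval₂_at_apply]
  have : P.eval z = 0 := by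
    funext r
    have h := hz r
    rw [Polynomial.eval_map] at h
    have h2 := Polynomial.eval₂_at_apply (p := P) (Pi.evalRingHom (fun _ : ℕ => ℂ) r) z
    simp only [Pi.evalRingHom_apply] at h2
    rw [← h2]; exact h
  rw [this, map_zero]

lemma lift_seq {n : ℕ} (t : ℕ) (p : ℕ → MvPolynomial (Fin n) ℂ) (hp : ∀ r, (p r).totalDegree ≤ t) :
    ∃ F : MvPolynomial (Fin n) (ℕ → ℂ), ∀ r, map (Pi.evalRingHom (fun _ => ℂ) r) F = p r := by
  classical
  have hfin : {α : Fin n →₀ ℕ | α.degree ≤ t}.Finite := Finsupp.finite_of_degree_le t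
  refine ⟨∑ α ∈ hfin.toFinset, monomial α (fun r => coeff α (p r)), fun r => ?_⟩
  rw [map_sum]
  simp only [map_monomial, Pi.evalRingHom_apply]
  conv_rhs => rw [as_sum (p r)]
  symm
  apply Finset.sum_subset
  · intro α hα
    simp only [Set.Finite.mem_toFinset, Set.mem_ofPred_eq]
    exact (le_totalDegree hα).trans (hp r)
  · intro α _ hα
    rw [notMem_support_iff.1 hα, monomial_zero]

lemma up_null {n : ℕ} (t : ℕ) (S : ℕ → Submodule ℂ (MvPolynomial (Fin n) ℂ))
    (hX : ∀ D : ℕ, ∀ᶠ r in atTop, ∀ f ∈ S r, f.totalDegree ≤ D → ∀ i, X i * f ∈ S r)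
    (hsq : ∀ D : ℕ, ∀ᶠ r in atTop, ∀ f : MvPolynomial (Fin n) ℂ,
      f.totalDegree ≤ D → f * f ∈ S r → f ∈ S r)
    (p : ℕ → MvPolynomial (Fin n) ℂ) (hp : ∀ r, (p r).totalDegree ≤ t) (hpS : ∀ r, p r ∉ S r) :
    ∃ r, ∃ z : Fin n → ℂ, eval z (p r) ≠ 0 ∧ ∀ f ∈ S r, f.totalDegree ≤ t → eval z f = 0 := by
  classical
  let U : Ultrafilter ℕ := hyperfilter ℕ
  have hU : (U : Filter ℕ) ≤ atTop := by
    rw [← Nat.cofinite_eq_atTop]; exact hyperfilter_le_cofinite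
  let K := Germ (U : Filter ℕ) ℂ
  have : IsAlgClosed K := germ_isAlgClosed U
  let q : (ℕ → ℂ) →+* K := Germ.coeRingHom (U : Filter ℕ)
  have hsurj : Function.Surjective q := by
    intro x
    induction x using Germ.inductionOn with
    | _ f => exact ⟨f, rfl⟩
  have hq0 : ∀ f, q f = 0 ↔ ∀ᶠ r in (U : Filter ℕ), f r = 0 := by
    intro f
    exact Germ.coe_eq
  let e (r : ℕ) : MvPolynomial (Fin n) (ℕ → ℂ) →+* MvPolynomial (Fin n) ℂ :=
    map (Pi.evalRingHom (fun _ => ℂ) r)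
  have hdeg : ∀ F r, (e r F).totalDegree ≤ F.totalDegree := fun F r => Finset.sup_mono (support_map_subset _ _)
  have hev : ∀ (Z : Fin n → ℕ → ℂ) F r, eval (fun i => Z i r) (e r F) = eval Z F r := by
    intro Z F r
    have := (eval₂_comp_left (Pi.evalRingHom (fun _ : ℕ => ℂ) r) (RingHom.id _) Z F)
    simp only [e, eval_map]
    exact this.symm
  have hevq : ∀ (Z : Fin n → ℕ → ℂ) F, eval (fun i => q (Z i)) (map q F) = q (eval Z F) := by
    intro Z F
    have := (eval₂_comp_left q (RingHom.id _) Z F)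
    simp only [eval_map]
    exact this.symm
  let I : Ideal (MvPolynomial (Fin n) (ℕ → ℂ)) :=
    { carrier := {F | ∀ᶠ r in (U : Filter ℕ), e r F ∈ S r}
      add_mem' := by
        intro F G hF hG
        simp only [Set.mem_ofPred_eq] at *
        filter_upwards [hF, hG] with r h1 h2
        rw [map_add]; exact (S r).add_mem h1 h2
      zero_mem' := by
        simp only [Set.mem_ofPred_eq, map_zero]
        exact Eventually.of_forall fun r => (S r).zero_mem
      smul_mem' := by
        intro c F hF
        simp only [Set.mem_ofPred_eq, smul_eq_mul] at *
        induction c using MvPolynomial.induction_on generalizing F with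
        | C a =>
          filter_upwards [hF] with r h1
          have : e r (C a * F) = a r • e r F := by
            rw [map_mul]; simp only [e, map_C]; rw [smul_eq_C_mul]; rfl
          rw [this]; exact (S r).smul_mem _ h1
        | add a b ha hb =>
          filter_upwards [ha hF, hb hF] with r h1 h2
          rw [add_mul, map_add]; exact (S r).add_mem h1 h2
        | mul_X a i ha =>
          have : ∀ᶠ r in (U : Filter ℕ), e r (X i * F) ∈ S r := by
            filter_upwards [hF, hU (hX F.totalDegree)] with r h1 h2
            rw [map_mul]; simp only [e, map_X]
            exact h2 _ h1 (hdeg F r) i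
          have := ha this
          rwa [mul_assoc] }
  have hmsurj : Function.Surjective (map (σ := Fin n) q) := map_surjective q hsurj
  have hker : ∀ F, map q F = 0 → F ∈ I := by
    intro F hF
    have h1 : ∀ α ∈ F.support, ∀ᶠ r in (U : Filter ℕ), coeff α F r = 0 := by
      intro α _
      rw [← hq0, ← coeff_map, hF, coeff_zero]
    have h2 := (Finset.eventually_all F.support).2 h1
    change ∀ᶠ r in (U : Filter ℕ), e r F ∈ S r
    filter_upwards [h2] with r hr
    have : e r F = 0 := by
      ext α
      simp only [e, coeff_map, coeff_zero, Pi.evalRingHom_apply]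
      by_cases hα : α ∈ F.support
      · exact hr α hα
      · rw [notMem_support_iff.1 hα]; rfl
    rw [this]; exact (S r).zero_mem
  let J : Ideal (MvPolynomial (Fin n) K) := I.map (map q)
  have hJ : ∀ F, map q F ∈ J → F ∈ I := by
    intro F hF
    obtain ⟨G, hG, hGF⟩ := (Ideal.mem_map_iff_of_surjective _ hmsurj).1 hF
    have := hker (F - G) (by rw [map_sub, hGF, sub_self])
    have h := I.add_mem this hG
    rwa [sub_add_cancel] at h
  have hrad : J.radical = J := by
    rw [Ideal.radical_eq_iff, Ideal.isRadical_iff_pow_one_lt 2 (by norm_num)] 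
    intro f hf
    obtain ⟨F, rfl⟩ := hmsurj f
    rw [← map_pow] at hf
    have h1 : ∀ᶠ r in (U : Filter ℕ), e r (F ^ 2) ∈ S r := hJ _ hf
    apply Ideal.mem_map_of_mem
    change ∀ᶠ r in (U : Filter ℕ), e r F ∈ S r
    filter_upwards [h1, hU (hsq F.totalDegree)] with r h1 h2
    refine h2 _ (hdeg F r) ?_
    rwa [map_pow, pow_two] at h1
  obtain ⟨P, hP⟩ := lift_seq t p hp
  have hPJ : map q P ∉ J := by
    intro h
    have h1 : ∀ᶠ r in (U : Filter ℕ), e r P ∈ S r := hJ _ h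
    obtain ⟨r, hr⟩ := h1.exists
    exact hpS r (by rw [← hP r]; exact hr)
  have hnull := vanishingIdeal_zeroLocus_eq_radical (K := K) J
  rw [hrad] at hnull
  rw [← hnull, mem_vanishingIdeal_iff] at hPJ
  push Not at hPJ
  obtain ⟨z, hz, hzP⟩ := hPJ
  choose Z hZ using fun i => hsurj (z i)
  have hz' : z = fun i => q (Z i) := by funext i; exact (hZ i).symm
  have hzP' : ∀ᶠ r in (U : Filter ℕ), eval (fun i => Z i r) (p r) ≠ 0 := by
    have h0 : ¬ ∀ᶠ r in (U : Filter ℕ), eval Z P r = 0 := by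
      rw [← hq0, ← hevq, ← hz']; exact hzP
    rw [← Ultrafilter.eventually_not] at h0
    filter_upwards [h0] with r hr
    rw [← hP r]
    change eval (fun i => Z i r) (e r P) ≠ 0
    rwa [hev]
  have hgood : ∀ᶠ r in (U : Filter ℕ), ∀ f ∈ S r, f.totalDegree ≤ t →
      eval (fun i => Z i r) f = 0 := by
    by_contra hcon
    rw [← Ultrafilter.eventually_not] at hcon
    have : ∀ r, ∃ f : MvPolynomial (Fin n) ℂ, f ∈ S r ∧ f.totalDegree ≤ t ∧
        ((¬ ∀ f ∈ S r, f.totalDegree ≤ t → eval (fun i => Z i r) f = 0) →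
          eval (fun i => Z i r) f ≠ 0) := by
      intro r
      by_cases h : ∀ f ∈ S r, f.totalDegree ≤ t → eval (fun i => Z i r) f = 0
      · exact ⟨0, (S r).zero_mem, by simp, fun h' => absurd h h'⟩
      · have h' := h
        push Not at h'
        obtain ⟨f, h1, h2, h3⟩ := h'
        exact ⟨f, h1, h2, fun _ => h3⟩
    choose f hf1 hf2 hf3 using this
    obtain ⟨F, hF⟩ := lift_seq t f hf2
    have hFI : F ∈ I := by
      change ∀ᶠ r in (U : Filter ℕ), e r F ∈ S r
      refine Eventually.of_forall fun r => ?_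
      change MvPolynomial.map _ F ∈ S r
      rw [hF r]; exact hf1 r
    have h0 : eval z (map q F) = 0 := by
      have := (mem_zeroLocus_iff.1 hz) _ (Ideal.mem_map_of_mem (map q) hFI)
      exact this
    rw [hz', hevq, hq0] at h0
    obtain ⟨r, h1, h2⟩ := (h0.and hcon).exists
    apply hf3 r h2
    rw [← hF r, ← h1]
    exact hev Z F r
  obtain ⟨r, h1, h2⟩ := (hzP'.and hgood).exists
  exact ⟨r, _, h1, h2⟩
end UP
section Ops
open MvPolynomial

variable {n : ℕ} {H : Type} [NormedAddCommGroup H] [InnerProductSpace ℂ H]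

def wd (A : Fin n → Module.End ℂ H) (l : List (Fin n)) : Module.End ℂ H := (l.map A).prod

noncomputable def evA (A : Fin n → Module.End ℂ H) :
    MvPolynomial (Fin n) ℂ →ₗ[ℂ] Module.End ℂ H :=
  (basisMonomials (Fin n) ℂ).constr ℂ (fun α => wd A (Finsupp.toMultiset α).toList)

def WW (A : Fin n → Module.End ℂ H) : ℕ → Submodule ℂ H
  | 0 => ⨅ i, ⨅ j, LinearMap.ker (A i * A j - A j * A i)
  | R + 1 => WW A R ⊓ ⨅ i, (WW A R).comap (A i)

noncomputable def evv (A : Fin n → Module.End ℂ H) (v : H) : MvPolynomial (Fin n) ℂ →ₗ[ℂ] H :=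
  (LinearMap.applyₗ v).comp (evA A)

noncomputable def VV (A : Fin n → Module.End ℂ H) (v : H) (t : ℕ) : Submodule ℂ H :=
  (restrictTotalDegree (Fin n) ℂ t).map (evv A v)

lemma evv_apply (A : Fin n → Module.End ℂ H) (v : H) (f) : evv A v f = evA A f v := rfl

lemma mem_VV (A : Fin n → Module.End ℂ H) (v : H) (t : ℕ) (x : H) :
    x ∈ VV A v t ↔ ∃ f : MvPolynomial (Fin n) ℂ, f.totalDegree ≤ t ∧ evA A f v = x := by
  simp only [VV, Submodule.mem_map, mem_restrictTotalDegree, evv_apply]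

lemma evA_monomial (A : Fin n → Module.End ℂ H) (α : Fin n →₀ ℕ) (c : ℂ) :
    evA A (monomial α c) = c • wd A (Finsupp.toMultiset α).toList := by
  have : monomial α c = c • basisMonomials (Fin n) ℂ α := by
    simp [smul_monomial]
  rw [this, map_smul, evA, Module.Basis.constr_basis]

lemma deg_ind {P : MvPolynomial (Fin n) ℂ → Prop} (D : ℕ) (h0 : P 0)
    (hadd : ∀ f g, P f → P g → P (f + g))
    (hmon : ∀ α c, (Finsupp.toMultiset α).card ≤ D → P (monomial α c))
    (f : MvPolynomial (Fin n) ℂ) (hf : f.totalDegree ≤ D) : P f := by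
  rw [as_sum f]
  refine Finset.sum_induction _ P hadd h0 fun α hα => hmon α _ ?_
  rw [Finsupp.card_toMultiset]
  exact (le_totalDegree hα).trans hf

lemma WW_anti (A : Fin n → Module.End ℂ H) : Antitone (WW A) :=
  antitone_nat_of_succ_le fun _ => inf_le_left

lemma wd_mem (A : Fin n → Module.End ℂ H) (l : List (Fin n)) (k R : ℕ) (h : k + l.length ≤ R)
    (v : H) (hv : v ∈ WW A R) : wd A l v ∈ WW A k := by
  induction l generalizing k with
  | nil => exact WW_anti A (by simpa using h) hv
  | cons a l ih =>
    have h1 := ih (k + 1) (by simp at h; omega)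
    have h2 : wd A l v ∈ ⨅ i, (WW A k).comap (A i) := h1.2
    rw [Submodule.mem_iInf] at h2
    exact h2 a

lemma comm_of_mem (A : Fin n → Module.End ℂ H) (v : H) (hv : v ∈ WW A 0) (i j : Fin n) :
    A i (A j v) = A j (A i v) := by
  change v ∈ ⨅ i, ⨅ j, LinearMap.ker (A i * A j - A j * A i) at hv
  simp only [Submodule.mem_iInf] at hv
  have := hv i j
  rw [LinearMap.mem_ker] at this
  exact sub_eq_zero.1 this

lemma wd_perm (A : Fin n → Module.End ℂ H) {l l' : List (Fin n)} (hp : l.Perm l') (R : ℕ)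
    (h : l.length ≤ R) (v : H) (hv : v ∈ WW A R) : wd A l v = wd A l' v := by
  induction hp with
  | nil => rfl
  | cons x hp ih =>
    have := ih (by simp at h; omega)
    exact congrArg (A x) this
  | swap x y l =>
    exact comm_of_mem A _ (wd_mem A l 0 R (by simp at h; omega) v hv) y x
  | trans h1 h2 ih1 ih2 =>
    exact (ih1 h).trans (ih2 (by rw [← h1.length_eq]; exact h))

lemma wd_append (A : Fin n → Module.End ℂ H) (l l' : List (Fin n)) :
    wd A (l ++ l') = wd A l * wd A l' := by
  simp [wd]

lemma evA_mul (A : Fin n → Module.End ℂ H) (R a b : ℕ) (hab : a + b ≤ R) (v : H)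
    (hv : v ∈ WW A R) (f g : MvPolynomial (Fin n) ℂ) (hf : f.totalDegree ≤ a)
    (hg : g.totalDegree ≤ b) : evA A (f * g) v = evA A f (evA A g v) := by
  refine deg_ind (P := fun f => evA A (f * g) v = evA A f (evA A g v)) a ?_ ?_ ?_ f hf
  · simp
  · intro f1 f2 h1 h2
    rw [add_mul, map_add, map_add, LinearMap.add_apply, h1, h2, LinearMap.add_apply]
  · intro α c hα
    refine deg_ind (P := fun g => evA A (monomial α c * g) v = evA A (monomial α c) (evA A g v))
      b ?_ ?_ ?_ g hg
    · simp
    · intro f1 f2 h1 h2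
      rw [mul_add, map_add, map_add, LinearMap.add_apply, h1, h2, LinearMap.add_apply, map_add]
    · intro β d hβ
      rw [monomial_mul, evA_monomial, evA_monomial, evA_monomial]
      simp only [LinearMap.smul_apply, map_smul]
      rw [smul_smul, mul_comm d c, map_add, ← Module.End.mul_apply, ← wd_append]
      congr 1
      refine wd_perm A ?_ R ?_ v hv
      · rw [← Multiset.coe_eq_coe]; simp [← Multiset.coe_add]
      · simp only [Multiset.length_toList, Multiset.card_add]; omega

lemma evA_mem (A : Fin n → Module.End ℂ H) (k D R : ℕ) (h : k + D ≤ R) (v : H)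
    (hv : v ∈ WW A R) (f : MvPolynomial (Fin n) ℂ) (hf : f.totalDegree ≤ D) :
    evA A f v ∈ WW A k := by
  refine deg_ind (P := fun f => evA A f v ∈ WW A k) D ?_ ?_ ?_ f hf
  · simp
  · intro f1 f2 h1 h2
    rw [map_add]; exact (WW A k).add_mem h1 h2
  · intro α c hα
    rw [evA_monomial]
    refine (WW A k).smul_mem _ (wd_mem A _ k R ?_ v hv)
    rw [Multiset.length_toList]; omega

lemma evA_X (A : Fin n → Module.End ℂ H) (i : Fin n) : evA A (X i) = A i := by
  rw [X, evA_monomial, Finsupp.toMultiset_single]; simp [wd]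

lemma evA_one (A : Fin n → Module.End ℂ H) : evA A 1 = 1 := by
  have : (1 : MvPolynomial (Fin n) ℂ) = monomial 0 1 := rfl
  rw [this, evA_monomial]; simp [wd]

noncomputable def cj (f : MvPolynomial (Fin n) ℂ) : MvPolynomial (Fin n) ℂ :=
  map (starRingEnd ℂ) f

lemma cj_deg (f : MvPolynomial (Fin n) ℂ) : (cj f).totalDegree ≤ f.totalDegree :=
  Finset.sup_mono (support_map_subset _ _)

lemma cj_cj (f : MvPolynomial (Fin n) ℂ) : cj (cj f) = f := by
  ext α; simp [cj, coeff_map]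

lemma wd_adj (A : Fin n → Module.End ℂ H) (hA : ∀ i, (A i).IsSymmetric) (l : List (Fin n))
    (v w : H) : inner ℂ (wd A l v) w = inner ℂ v (wd A l.reverse w) := by
  induction l generalizing w with
  | nil => rfl
  | cons a l ih =>
    rw [List.reverse_cons, wd_append]
    have h1 : wd A (a :: l) v = A a (wd A l v) := rfl
    have h2 : (wd A l.reverse * wd A [a]) w = wd A l.reverse (A a w) := by simp [wd]
    rw [h1, h2, hA a, ih]

lemma evA_adj (A : Fin n → Module.End ℂ H) (hA : ∀ i, (A i).IsSymmetric) (R : ℕ) (v w : H)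
    (hw : w ∈ WW A R) (f : MvPolynomial (Fin n) ℂ) (hf : f.totalDegree ≤ R) :
    inner ℂ (evA A f v) w = inner ℂ v (evA A (cj f) w) := by
  refine deg_ind (P := fun f => inner ℂ (evA A f v) w = inner ℂ v (evA A (cj f) w)) R
    ?_ ?_ ?_ f hf
  · simp [cj]
  · intro f1 f2 h1 h2
    have : cj (f1 + f2) = cj f1 + cj f2 := map_add _ _ _
    rw [this, map_add, map_add, LinearMap.add_apply, LinearMap.add_apply, inner_add_left,
      inner_add_right, h1, h2]
  · intro α c hα
    rw [cj, map_monomial, evA_monomial, evA_monomial, LinearMap.smul_apply, LinearMap.smul_apply,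
      inner_smul_left, inner_smul_right, wd_adj A hA]
    congr 2
    exact wd_perm A (List.reverse_perm _) R (by simpa using hα) w hw

lemma VV_orth (A : Fin n → Module.End ℂ H) (hA : ∀ i, (A i).IsSymmetric) (R s t : ℕ)
    (hR : s + t ≤ R) (v v' : H) (hv : v ∈ WW A R)
    (h : ∀ x ∈ VV A v (s + t), inner ℂ v' x = 0) :
    ∀ x ∈ VV A v' t, ∀ y ∈ VV A v s, inner ℂ x y = 0 := by
  intro x hx y hy
  rw [mem_VV] at hx hy
  obtain ⟨f, hf, rfl⟩ := hx
  obtain ⟨g, hg, rfl⟩ := hy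
  rw [evA_adj A hA t v' _ (evA_mem A t s R (by omega) v hv g hg) f hf,
    ← evA_mul A R t s (by omega) v hv _ _ ((cj_deg f).trans hf) hg]
  apply h
  rw [mem_VV]
  refine ⟨_, ?_, rfl⟩
  have := totalDegree_mul (cj f) g
  have := cj_deg f
  omega

lemma sq_zero (A : Fin n → Module.End ℂ H) (hA : ∀ i, (A i).IsSymmetric) (D R : ℕ)
    (hR : 4 * D ≤ R) (v : H) (hv : v ∈ WW A R) (f : MvPolynomial (Fin n) ℂ)
    (hf : f.totalDegree ≤ D) (h : evA A (f * f) v = 0) : evA A f v = 0 := by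
  have hcf := (cj_deg f).trans hf
  have hu : evA A f v ∈ WW A (3 * D) := evA_mem A _ D R (by omega) v hv f hf
  have h1 : evA A f (evA A f v) = 0 := by
    rw [← evA_mul A R D D (by omega) v hv f f hf hf, h]
  have hw : evA A (cj f) (evA A f v) ∈ WW A (2 * D) :=
    evA_mem A _ D (3 * D) (by omega) _ hu _ hcf
  have h2 : evA A (cj f) (evA A f v) = 0 := by
    rw [← inner_self_eq_zero (𝕜 := ℂ), evA_adj A hA (2 * D) _ _ hw _ (by omega), cj_cj,
      ← evA_mul A (3 * D) D D (by omega) _ hu _ _ hf hcf, mul_comm,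
      evA_mul A (3 * D) D D (by omega) _ hu _ _ hcf hf, h1, map_zero, inner_zero_right]
  rw [← inner_self_eq_zero (𝕜 := ℂ), evA_adj A hA (3 * D) _ _ hu _ (by omega), h2,
    inner_zero_right]

end Ops
section Piece
open MvPolynomial

lemma exists_point (n t : ℕ) : ∃ R : ℕ, ∀ (H : Type) [NormedAddCommGroup H]
    [InnerProductSpace ℂ H] (A : Fin n → Module.End ℂ H), (∀ i, (A i).IsSymmetric) →
    ∀ v ∈ WW A R, ∀ p : MvPolynomial (Fin n) ℂ, p.totalDegree ≤ t → evA A p v ≠ 0 →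
    ∃ z : Fin n → ℂ, eval z p ≠ 0 ∧ ∀ f : MvPolynomial (Fin n) ℂ, f.totalDegree ≤ t →
      evA A f v = 0 → eval z f = 0 := by
  by_contra hcon
  have key : ∀ R : ℕ, ∃ S : Submodule ℂ (MvPolynomial (Fin n) ℂ), ∃ p : MvPolynomial (Fin n) ℂ,
      (∀ D, D + 1 ≤ R → ∀ f ∈ S, f.totalDegree ≤ D → ∀ i, X i * f ∈ S) ∧
      (∀ D, 4 * D ≤ R → ∀ f : MvPolynomial (Fin n) ℂ, f.totalDegree ≤ D → f * f ∈ S → f ∈ S) ∧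
      p.totalDegree ≤ t ∧ p ∉ S ∧
      ¬ ∃ z : Fin n → ℂ, eval z p ≠ 0 ∧ ∀ f ∈ S, f.totalDegree ≤ t → eval z f = 0 := by
    intro R
    by_contra hR
    apply hcon
    refine ⟨R, ?_⟩
    intro H _ _ A hA v hv p hp hpv
    by_contra hz
    apply hR
    refine ⟨LinearMap.ker (evv A v), p, ?_, ?_, hp, ?_, ?_⟩
    · intro D hD f hf hfD i
      rw [LinearMap.mem_ker, evv_apply] at hf ⊢
      rw [evA_mul A R 1 D (by omega) v hv _ _ (by rw [totalDegree_X]) hfD, hf, map_zero]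
    · intro D hD f hf h
      rw [LinearMap.mem_ker, evv_apply] at h ⊢
      exact sq_zero A hA D R hD v hv f hf h
    · rw [LinearMap.mem_ker, evv_apply]; exact hpv
    · rintro ⟨z, h1, h2⟩
      exact hz ⟨z, h1, fun f hf hfv => h2 f hfv hf⟩
  choose S p h1 h2 h3 h4 h5 using key
  obtain ⟨r, z, hz⟩ := up_null t S
    (fun D => Filter.eventually_atTop.2 ⟨D + 1, fun r hr => h1 r D hr⟩)
    (fun D => Filter.eventually_atTop.2 ⟨4 * D, fun r hr => h2 r D hr⟩) p h3 h4
  exact h5 r ⟨z, hz⟩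

/-- Block operators living on a subspace. -/
def Blk {n : ℕ} {H : Type} [NormedAddCommGroup H] [InnerProductSpace ℂ H]
    (E : Submodule ℂ H) (B : Fin n → Module.End ℂ H) : Prop :=
  (∀ i x, B i x ∈ E) ∧ (∀ i, ∀ x ∈ Eᗮ, B i x = 0) ∧ ∀ i j, B i * B j = B j * B i

lemma Blk.add {n : ℕ} {H : Type} [NormedAddCommGroup H] [InnerProductSpace ℂ H]
    {E E' : Submodule ℂ H} {B B' : Fin n → Module.End ℂ H} (h : Blk E B) (h' : Blk E' B')
    (hE : ∀ x ∈ E, ∀ y ∈ E', inner ℂ x y = 0) : Blk (E ⊔ E') (fun i => B i + B' i) := by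
  have ho : ∀ y ∈ E', y ∈ Eᗮ := fun y hy x hx => hE x hx y hy
  have ho' : ∀ y ∈ E, y ∈ E'ᗮ := fun y hy x hx => inner_eq_zero_symm.1 (hE y hy x hx)
  refine ⟨?_, ?_, ?_⟩
  · intro i x
    exact Submodule.add_mem_sup (h.1 i x) (h'.1 i x)
  · intro i x hx
    rw [LinearMap.add_apply, h.2.1 i x (Submodule.orthogonal_le le_sup_left hx),
      h'.2.1 i x (Submodule.orthogonal_le le_sup_right hx), add_zero]
  · intro i j
    have e1 : ∀ i j, B i * B' j = 0 := fun i j => by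
      ext x; exact h.2.1 i _ (ho _ (h'.1 j x))
    have e2 : ∀ i j, B' i * B j = 0 := fun i j => by
      ext x; exact h'.2.1 i _ (ho' _ (h.1 j x))
    rw [add_mul, add_mul, mul_add, mul_add, mul_add, mul_add, e1, e2, e1, e2, h.2.2 i j,
      h'.2.2 i j]

lemma Blk.ofEnd {n : ℕ} {H : Type} [NormedAddCommGroup H] [InnerProductSpace ℂ H]
    [FiniteDimensional ℂ H]
    (E : Submodule ℂ H) (b : Fin n → Module.End ℂ E) (hb : ∀ i j, b i * b j = b j * b i) :
    ∃ B : Fin n → Module.End ℂ H, Blk E B ∧ ∀ i (x : E), B i x = b i x := by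
  let P : H →ₗ[ℂ] E := E.orthogonalProjectionOnto.toLinearMap
  have hP : ∀ x : E, P x = x := fun x => E.orthogonalProjectionOnto_mem_subspace_eq_self x
  refine ⟨fun i => E.subtype ∘ₗ b i ∘ₗ P, ⟨?_, ?_, ?_⟩, ?_⟩
  · intro i x; exact (b i (P x)).2
  · intro i x hx
    have : P x = 0 := E.orthogonalProjectionOnto_apply_of_mem_orthogonal hx
    simp [this]
  · intro i j
    ext x
    have := LinearMap.congr_fun (hb i j) (P x)
    simp only [Module.End.mul_apply, LinearMap.comp_apply, Submodule.subtype_apply, hP] at this ⊢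
    rw [this]
  · intro i x
    simp [hP]

/-- A family of functionals separating points gives a simultaneous diagonalisation. -/
lemma diag_of_sep {n : ℕ} {V : Type} [AddCommGroup V] [Module ℂ V] [FiniteDimensional ℂ V]
    (Z : Set (Fin n → ℂ)) (φ : Z → Module.Dual ℂ V)
    (hsep : ∀ x : V, x ≠ 0 → ∃ z, φ z x ≠ 0) :
    ∃ b : Fin n → Module.End ℂ V, (∀ i j, b i * b j = b j * b i) ∧
      ∀ i x y, (∀ z : Z, φ z y = z.1 i * φ z x) → b i x = y := by
  classical
  have hspan : Submodule.span ℂ (Set.range φ) = ⊤ := by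
    rw [← Subspace.dualCoannihilator_dualAnnihilator_eq (W := Submodule.span ℂ (Set.range φ))]
    have : (Submodule.span ℂ (Set.range φ)).dualCoannihilator = ⊥ := by
      rw [eq_bot_iff]
      intro x hx
      rw [Submodule.mem_dualCoannihilator] at hx
      by_contra h0
      obtain ⟨z, hz⟩ := hsep x h0
      exact hz (hx _ (Submodule.subset_span ⟨z, rfl⟩))
    rw [this, Submodule.dualAnnihilator_bot]
  obtain ⟨κ, a, ha, hsp, hli⟩ := exists_linearIndependent' ℂ φ
  rw [hspan] at hsp
  let β := Module.Basis.mk hli hsp.ge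
  have : Finite κ := Module.Finite.finite_basis β
  have := Fintype.ofFinite κ
  let e₀ : V →ₗ[ℂ] (κ → ℂ) := LinearMap.pi fun k => φ (a k)
  have hinj : Function.Injective e₀ := by
    rw [← LinearMap.ker_eq_bot, eq_bot_iff]
    intro x hx
    by_contra h0
    obtain ⟨z, hz⟩ := hsep x h0
    have h1 : ∀ k, φ (a k) x = 0 := fun k => congrFun (LinearMap.mem_ker.1 hx) k
    have h2 : φ z ∈ Submodule.span ℂ (Set.range (φ ∘ a)) := by rw [hsp]; trivial
    apply hz
    refine Submodule.span_induction (p := fun (f : Module.Dual ℂ V) _ => f x = 0)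
      ?_ ?_ ?_ ?_ h2
    · rintro _ ⟨k, rfl⟩; exact h1 k
    · rfl
    · intro f g _ _ hf hg; rw [LinearMap.add_apply, hf, hg, add_zero]
    · intro c f _ hf; rw [LinearMap.smul_apply, hf, smul_zero]
  have hdim : Module.finrank ℂ V = Module.finrank ℂ (κ → ℂ) := by
    rw [Module.finrank_fintype_fun_eq_card, ← Subspace.dual_finrank_eq,
      Module.finrank_eq_card_basis β]
  let e : V ≃ₗ[ℂ] (κ → ℂ) := LinearEquiv.ofInjectiveOfFinrankEq e₀ hinj hdim
  have he : ∀ x k, e x k = φ (a k) x := fun x k => rfl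
  let m (i : Fin n) : Module.End ℂ (κ → ℂ) := LinearMap.pi fun k => (a k).1 i • LinearMap.proj k
  refine ⟨fun i => e.symm.toLinearMap ∘ₗ m i ∘ₗ e.toLinearMap, ?_, ?_⟩
  · intro i j
    ext x
    simp only [Module.End.mul_apply, LinearMap.comp_apply, LinearEquiv.coe_coe,
      LinearEquiv.apply_symm_apply]
    congr 1
    funext k
    simp only [m, LinearMap.pi_apply, LinearMap.smul_apply, LinearMap.proj_apply, smul_eq_mul]
    ring
  · intro i x y h
    simp only [LinearMap.comp_apply, LinearEquiv.coe_coe]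
    rw [LinearEquiv.symm_apply_eq]
    funext k
    rw [he, h]
    rfl

lemma piece (n t : ℕ) : ∃ R : ℕ, ∀ (H : Type) [NormedAddCommGroup H]
    [InnerProductSpace ℂ H] [FiniteDimensional ℂ H] (A : Fin n → Module.End ℂ H),
    (∀ i, (A i).IsSymmetric) →
    ∀ v ∈ WW A R, ∃ B : Fin n → Module.End ℂ H, Blk (VV A v (t + 1)) B ∧
      ∀ i, ∀ x ∈ VV A v t, B i x = A i x := by
  obtain ⟨R₀, hR₀⟩ := exists_point n (t + 1)
  refine ⟨max R₀ (t + 1), ?_⟩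
  intro H _ _ _ A hA v hv
  have hpt := hR₀ H A hA v (WW_anti A (le_max_left _ _) hv)
  have hv' := WW_anti A (le_max_right R₀ (t + 1)) hv
  let Z : Set (Fin n → ℂ) := {z | ∀ f : MvPolynomial (Fin n) ℂ, f.totalDegree ≤ t + 1 →
      evA A f v = 0 → eval z f = 0}
  let V := VV A v (t + 1)
  let g : restrictTotalDegree (Fin n) ℂ (t + 1) →ₗ[ℂ] V :=
    (evv A v).submoduleMap _
  have hg : ∀ f, (g f : H) = evA A f.1 v := fun f => rfl
  have hgs : LinearMap.range g = ⊤ := by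
    rw [LinearMap.range_eq_top]; exact LinearMap.submoduleMap_surjective _ _
  obtain ⟨σ, hσ⟩ := g.exists_rightInverse_of_surjective hgs
  have hσ' : ∀ x, g (σ x) = x := fun x => LinearMap.congr_fun hσ x
  let φ : Z → Module.Dual ℂ V := fun z =>
    (aeval z.1).toLinearMap ∘ₗ (restrictTotalDegree (Fin n) ℂ (t + 1)).subtype ∘ₗ σ
  have hφ : ∀ (z : Z) (x : V) (f : MvPolynomial (Fin n) ℂ), f.totalDegree ≤ t + 1 →
      evA A f v = x → φ z x = eval z.1 f := by
    intro z x f hf hx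
    have h1 : φ z x = eval z.1 (σ x).1 := rfl
    rw [h1, ← sub_eq_zero, ← map_sub]
    apply z.2
    · exact (totalDegree_sub _ _).trans
        (max_le ((mem_restrictTotalDegree _ _ _).1 (σ x).2) hf)
    · rw [map_sub, LinearMap.sub_apply, hx, ← hg, hσ', sub_self]
  obtain ⟨b, hb1, hb2⟩ := diag_of_sep Z φ (by
    intro x hx
    obtain ⟨f, hf, hfx⟩ := (mem_VV _ _ _ _).1 x.2
    obtain ⟨z, hz1, hz2⟩ := hpt f hf (by
      rw [hfx]; simpa using hx)
    exact ⟨⟨z, hz2⟩, by rw [hφ _ x f hf hfx]; exact hz1⟩)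
  obtain ⟨B, hB1, hB2⟩ := Blk.ofEnd V b hb1
  refine ⟨B, hB1, ?_⟩
  intro i x hx
  obtain ⟨f, hf, hfx⟩ := (mem_VV _ _ _ _).1 hx
  have hd : (X i * f).totalDegree ≤ t + 1 := by
    have := totalDegree_mul (X i) f
    rw [totalDegree_X] at this
    omega
  have hm : evA A (X i * f) v = A i x := by
    rw [evA_mul A (t + 1) 1 t (by omega) v hv' _ _ (by rw [totalDegree_X]) hf, hfx, evA_X]
  let x' : V := ⟨x, (mem_VV _ _ _ _).2 ⟨f, by omega, hfx⟩⟩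
  let y' : V := ⟨A i x, (mem_VV _ _ _ _).2 ⟨_, hd, hm⟩⟩
  have := hb2 i x' y' (by
    intro z
    rw [hφ z y' _ hd hm, hφ z x' f (by omega) hfx, map_mul, eval_X])
  have h3 := hB2 i x'
  rw [this] at h3
  exact h3

end Piece
section Scales

lemma good_scale (n : ℕ) (η : ℝ) (h0 : 0 < η) (h1 : η < 1) : ∃ T : ℕ, ∀ a : ℕ → ℕ, Monotone a →
    1 ≤ a 0 → (∀ s, a s ≤ (s + 1) ^ n) →
    ∃ s ≤ T, (1 - η) * a (s + 1) ≤ a s ∧ a (2 * s + 2) ≤ 4 ^ (n + 1) * a (s + 1) := by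
  obtain ⟨k₀, hk₀⟩ := exists_pow_lt_of_lt_one
    (show (0 : ℝ) < 1 / 4 ^ (n + 1) by positivity) (show 1 - η < 1 by linarith)
  let K := (n + 1) * k₀ + n + 1
  refine ⟨4 ^ (K + 1), fun a ha ha0 hab => ?_⟩
  have hex : ∃ k, k₀ ≤ k ∧ k < K ∧ a (4 ^ (k + 1)) ≤ 4 ^ (n + 1) * a (4 ^ k) := by
    by_contra hcon
    push Not at hcon
    have hgrow : ∀ j, k₀ + j ≤ K → (4 ^ (n + 1)) ^ j ≤ a (4 ^ (k₀ + j)) := by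
      intro j
      induction j with
      | zero => intro _; simpa using ha0.trans (ha (Nat.zero_le _))
      | succ j ih =>
        intro hj
        have h2 := hcon (k₀ + j) (by omega) (by omega)
        have h3 := ih (by omega)
        calc (4 ^ (n + 1)) ^ (j + 1) = 4 ^ (n + 1) * (4 ^ (n + 1)) ^ j := by ring
          _ ≤ 4 ^ (n + 1) * a (4 ^ (k₀ + j)) := by gcongr
          _ ≤ _ := h2.le
    have hK : k₀ ≤ K := by simp only [K]; nlinarith
    have h2 := (hgrow (K - k₀) (by omega)).trans (hab _)
    rw [Nat.add_sub_cancel' hK, ← pow_mul] at h2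
    have h3 : (n + 1) * (K - k₀) = n * K + n + 1 := by
      obtain ⟨m, hm⟩ := Nat.exists_eq_add_of_le hK
      rw [hm, Nat.add_sub_cancel_left]
      have : k₀ + m = (n + 1) * k₀ + n + 1 := hm.symm
      nlinarith
    rw [h3] at h2
    have h4 : (4 ^ K + 1) ^ n ≤ (4 * 4 ^ K) ^ n := by
      have : 1 ≤ 4 ^ K := Nat.one_le_pow _ _ (by norm_num)
      gcongr
      omega
    have h5 : (4 * 4 ^ K) ^ n = 4 ^ (n * K + n) := by
      rw [← pow_succ', ← pow_mul]; ring_nf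
    have h6 : 4 ^ (n * K + n) < 4 ^ (n * K + n + 1) := Nat.pow_lt_pow_succ (by norm_num)
    omega
  obtain ⟨k, hk1, hk2, hk3⟩ := hex
  have hex2 : ∃ s, 4 ^ k ≤ s ∧ s < 2 * 4 ^ k ∧ (1 - η) * a (s + 1) ≤ a s := by
    by_contra hcon
    push Not at hcon
    have hgrow : ∀ j, j ≤ 4 ^ k → (a (4 ^ k) : ℝ) ≤ (1 - η) ^ j * a (4 ^ k + j) := by
      intro j
      induction j with
      | zero => intro _; simp
      | succ j ih =>
        intro hj
        have h2 := hcon (4 ^ k + j) (by omega) (by omega)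
        calc (a (4 ^ k) : ℝ) ≤ (1 - η) ^ j * a (4 ^ k + j) := ih (by omega)
          _ ≤ (1 - η) ^ j * ((1 - η) * a (4 ^ k + j + 1)) := by
            have : (0 : ℝ) ≤ (1 - η) ^ j := pow_nonneg (by linarith) _
            gcongr
          _ = _ := by rw [pow_succ]; ring_nf
    have h2 := hgrow (4 ^ k) le_rfl
    have h3 : a (4 ^ k + 4 ^ k) ≤ 4 ^ (n + 1) * a (4 ^ k) := by
      refine (ha ?_).trans hk3
      rw [pow_succ]; omega
    have h3' : (a (4 ^ k + 4 ^ k) : ℝ) ≤ 4 ^ (n + 1) * a (4 ^ k) := by exact_mod_cast h3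
    have h4 : (1 - η) ^ (4 ^ k) < 1 / 4 ^ (n + 1) := by
      refine lt_of_le_of_lt ?_ hk₀
      apply pow_le_pow_of_le_one (by linarith) (by linarith)
      exact hk1.trans (Nat.lt_pow_self (by norm_num)).le
    have h5 : (1 : ℝ) ≤ a (4 ^ k) := by exact_mod_cast ha0.trans (ha (Nat.zero_le _))
    have h6 : (0 : ℝ) ≤ (1 - η) ^ (4 ^ k) := pow_nonneg (by linarith) _
    have h7 : (1 - η) ^ (4 ^ k) * 4 ^ (n + 1) < 1 := by
      rwa [lt_div_iff₀ (by positivity)] at h4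
    have h8 : (a (4 ^ k) : ℝ) ≤ (1 - η) ^ (4 ^ k) * (4 ^ (n + 1) * a (4 ^ k)) :=
      h2.trans (mul_le_mul_of_nonneg_left h3' h6)
    nlinarith
  obtain ⟨s, hs1, hs2, hs3⟩ := hex2
  refine ⟨s, ?_, hs3, ?_⟩
  · have : 4 ^ (k + 1) ≤ 4 ^ (K + 1) := Nat.pow_le_pow_right (by norm_num) (by omega)
    rw [pow_succ] at this; omega
  · calc a (2 * s + 2) ≤ a (4 ^ (k + 1)) := ha (by rw [pow_succ]; omega)
      _ ≤ 4 ^ (n + 1) * a (4 ^ k) := hk3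
      _ ≤ _ := Nat.mul_le_mul_left _ (ha (by omega))

end Scales

section Tiling
open MvPolynomial Module

variable {n : ℕ} {H : Type} [NormedAddCommGroup H] [InnerProductSpace ℂ H]

lemma VV_mono (A : Fin n → Module.End ℂ H) (v : H) : Monotone (VV A v) := by
  intro s t h x hx
  rw [mem_VV] at *
  obtain ⟨f, hf, rfl⟩ := hx
  exact ⟨f, hf.trans h, rfl⟩

lemma self_mem_VV (A : Fin n → Module.End ℂ H) (v : H) (t : ℕ) : v ∈ VV A v t := by
  rw [mem_VV]
  exact ⟨1, by simp, by rw [evA_one]; rfl⟩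

variable [FiniteDimensional ℂ H]

lemma VV_finrank_le (A : Fin n → Module.End ℂ H) (v : H) (s : ℕ) :
    finrank ℂ (VV A v s) ≤ (s + 1) ^ n := by
  let g : (Fin n → Fin (s + 1)) → H := fun β =>
    evA A (monomial (Finsupp.equivFunOnFinite.symm fun i => (β i : ℕ)) 1) v
  have hle : VV A v s ≤ Submodule.span ℂ (Set.range g) := by
    intro x hx
    rw [mem_VV] at hx
    obtain ⟨f, hf, rfl⟩ := hx
    refine deg_ind (P := fun f => evA A f v ∈ Submodule.span ℂ (Set.range g)) s ?_ ?_ ?_ f hf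
    · simp
    · intro f g h1 h2; rw [map_add]; exact Submodule.add_mem _ h1 h2
    · intro α c hα
      have : evA A (monomial α c) v = c • evA A (monomial α 1) v := by
        rw [evA_monomial, evA_monomial, one_smul]; rfl
      rw [this]
      refine Submodule.smul_mem _ _ (Submodule.subset_span ⟨fun i => ⟨α i, ?_⟩, ?_⟩)
      · have := Multiset.count_le_card i (Finsupp.toMultiset α)
        rw [Finsupp.count_toMultiset] at this
        omega
      · simp only [g]
        have : (Finsupp.equivFunOnFinite.symm fun i => α i) = α := by ext i; rfl
        rw [this]
  calc _ ≤ finrank ℂ (Submodule.span ℂ (Set.range g)) := Submodule.finrank_mono hle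
    _ ≤ Fintype.card (Fin n → Fin (s + 1)) := finrank_range_le_card g
    _ = _ := by simp

lemma finrank_sup_orth (E F : Submodule ℂ H) (h : ∀ x ∈ E, ∀ y ∈ F, inner ℂ x y = 0) :
    finrank ℂ (E ⊔ F : Submodule ℂ H) = finrank ℂ E + finrank ℂ F := by
  have h1 := Submodule.finrank_sup_add_finrank_inf_eq E F
  have h2 : E ⊓ F = ⊥ := by
    rw [eq_bot_iff]
    rintro x ⟨hx, hy⟩
    exact inner_self_eq_zero.1 (h x hx x hy)
  rw [h2, finrank_bot] at h1
  exact h1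

def Til (A : Fin n → Module.End ℂ H) (W : Submodule ℂ H) (η : ℝ) (C : ℕ) (s : ℕ)
    (E E' F : Submodule ℂ H) (B : Fin n → Module.End ℂ H) : Prop :=
  Blk E B ∧ E' ≤ E ∧ (∀ i, ∀ x ∈ E', B i x = A i x) ∧
  (1 - η) * finrank ℂ E ≤ finrank ℂ E' ∧ finrank ℂ F ≤ C * finrank ℂ E ∧
  ∀ v ∈ W, (∀ x ∈ F, inner ℂ v x = 0) → ∀ t ≤ s + 1, ∀ x ∈ VV A v t, ∀ y ∈ E, inner ℂ x y = 0

def Good (A : Fin n → Module.End ℂ H) (η : ℝ) (C : ℕ) (v : H) (s : ℕ) : Prop :=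
  (1 - η) * finrank ℂ (VV A v (s + 1)) ≤ finrank ℂ (VV A v s) ∧
  finrank ℂ (VV A v (2 * s + 2)) ≤ C * finrank ℂ (VV A v (s + 1))

lemma Til.extend (A : Fin n → Module.End ℂ H) (hA : ∀ i, (A i).IsSymmetric) (R : ℕ) (η : ℝ)
    (C : ℕ) (s : ℕ) (hR : 2 * s + 2 ≤ R) (E E' F : Submodule ℂ H) (B : Fin n → Module.End ℂ H)
    (hT : Til A (WW A R) η C s E E' F B) (v : H) (hv : v ∈ WW A R) (hg : Good A η C v s)
    (hvF : ∀ x ∈ F, inner ℂ v x = 0) (B' : Fin n → Module.End ℂ H)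
    (hB' : Blk (VV A v (s + 1)) B') (hB'A : ∀ i, ∀ x ∈ VV A v s, B' i x = A i x) :
    Til A (WW A R) η C s (E ⊔ VV A v (s + 1)) (E' ⊔ VV A v s) (F ⊔ VV A v (2 * s + 2))
      (fun i => B i + B' i) ∧
    finrank ℂ (E ⊔ VV A v (s + 1) : Submodule ℂ H) =
      finrank ℂ E + finrank ℂ (VV A v (s + 1)) := by
  obtain ⟨h1, h2, h3, h4, h5, h6⟩ := hT
  have ho' := h6 v hv hvF (s + 1) le_rfl
  have ho : ∀ x ∈ E, ∀ y ∈ VV A v (s + 1), inner ℂ x y = 0 :=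
    fun x hx y hy => inner_eq_zero_symm.1 (ho' y hy x hx)
  have hss : VV A v s ≤ VV A v (s + 1) := VV_mono A v (Nat.le_succ s)
  have hd := finrank_sup_orth E _ ho
  refine ⟨⟨h1.add hB' ho, sup_le_sup h2 hss, ?_, ?_, ?_, ?_⟩, hd⟩
  · intro i x hx
    obtain ⟨a, ha, b, hb, rfl⟩ := Submodule.mem_sup.1 hx
    have e1 : B i b = 0 := h1.2.1 i b fun x hx => ho x hx b (hss hb)
    have e2 : B' i a = 0 := hB'.2.1 i a fun x hx => ho' x hx a (h2 ha)
    rw [LinearMap.add_apply, map_add, map_add, map_add, e1, e2, h3 i a ha, hB'A i b hb]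
    simp
  · rw [hd, finrank_sup_orth E' _ fun x hx y hy => ho x (h2 hx) y (hss hy)]
    have := hg.1
    push_cast
    linarith
  · rw [hd]
    have e1 := Submodule.finrank_add_le_finrank_add_finrank F (VV A v (2 * s + 2))
    have := hg.2
    rw [mul_add]
    omega
  · intro u hu huF t ht x hx y hy
    obtain ⟨a, ha, b, hb, rfl⟩ := Submodule.mem_sup.1 hy
    rw [inner_add_right, h6 u hu (fun x hx => huF x (Submodule.mem_sup_left hx)) t ht x hx a ha,
      zero_add]
    refine VV_orth A hA R (s + 1) t (by omega) v u hv ?_ x hx b hb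
    intro z hz
    exact huF z (Submodule.mem_sup_right (VV_mono A v (by omega) hz))

lemma tiling (A : Fin n → Module.End ℂ H) (hA : ∀ i, (A i).IsSymmetric) (R : ℕ) (η : ℝ)
    (C : ℕ) (T : ℕ) (hR : 2 * T + 2 ≤ R)
    (hpiece : ∀ v ∈ WW A R, ∀ s ≤ T, ∃ B : Fin n → Module.End ℂ H, Blk (VV A v (s + 1)) B ∧
      ∀ i, ∀ x ∈ VV A v s, B i x = A i x) (s : ℕ) (hs : s ≤ T + 1) :
    ∃ E E' F B, Til A (WW A R) η C s E E' F B ∧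
      ∀ v ∈ WW A R, v ≠ 0 → ∀ s', s ≤ s' → s' ≤ T → Good A η C v s' →
        ¬ ∀ x ∈ F, inner ℂ v x = 0 := by
  induction hs using Nat.decreasingInduction with
  | self =>
    refine ⟨⊥, ⊥, ⊥, 0, ⟨⟨?_, ?_, ?_⟩, le_rfl, ?_, ?_, ?_, ?_⟩, ?_⟩
    · intro i x; simp
    · intro i x _; rfl
    · intro i j; rfl
    · intro i x hx
      rw [(Submodule.mem_bot ℂ).1 hx, map_zero, map_zero]
    · simp
    · simp
    · intro v _ _ t _ x _ y hy
      rw [(Submodule.mem_bot ℂ).1 hy, inner_zero_right]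
    · intro v _ _ s' h1 h2; omega
  | of_succ s hsT ih =>
    by_contra hcon
    have key : ∀ m : ℕ, ∃ E E' F B, Til A (WW A R) η C s E E' F B ∧
        (∀ v ∈ WW A R, v ≠ 0 → ∀ s', s + 1 ≤ s' → s' ≤ T → Good A η C v s' →
        ¬ ∀ x ∈ F, inner ℂ v x = 0) ∧ m ≤ finrank ℂ E := by
      intro m
      induction m with
      | zero =>
        obtain ⟨E, E', F, B, ⟨h1, h2, h3, h4, h5, h6⟩, h⟩ := ih
        exact ⟨E, E', F, B, ⟨h1, h2, h3, h4, h5,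
          fun v hv hvF t ht => h6 v hv hvF t (by omega)⟩, h, Nat.zero_le _⟩
      | succ m ihm =>
        obtain ⟨E, E', F, B, hT, hF, hm⟩ := ihm
        have : ∃ v ∈ WW A R, v ≠ 0 ∧ Good A η C v s ∧ ∀ x ∈ F, inner ℂ v x = 0 := by
          by_contra hno
          apply hcon
          refine ⟨E, E', F, B, hT, ?_⟩
          intro v hv hv0 s' h1 h2 hg hvF
          rcases Nat.eq_or_lt_of_le h1 with h | h
          · subst h
            exact hno ⟨v, hv, hv0, hg, hvF⟩
          · exact hF v hv hv0 s' h h2 hg hvF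
        obtain ⟨v, hv, hv0, hg, hvF⟩ := this
        obtain ⟨B', hB', hB'A⟩ := hpiece v hv s (by omega)
        obtain ⟨h1, h2⟩ := hT.extend A hA R η C s (by omega) E E' F B v hv hg hvF B' hB' hB'A
        refine ⟨_, _, _, _, h1, ?_, ?_⟩
        · intro u hu hu0 s' h1 h2 hg' huF
          exact hF u hu hu0 s' h1 h2 hg' fun x hx => huF x (Submodule.mem_sup_left hx)
        · rw [h2]
          have : 0 < finrank ℂ (VV A v (s + 1)) := by
            have : Nontrivial (VV A v (s + 1)) :=
              ⟨⟨⟨v, self_mem_VV A v _⟩, 0, fun h => hv0 (congrArg Subtype.val h)⟩⟩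
            exact finrank_pos
          omega
    obtain ⟨E, E', F, B, _, _, h⟩ := key (finrank ℂ H + 1)
    have := Submodule.finrank_le E
    omega

end Tiling

section Round
open Module

lemma round_exists (n : ℕ) (η : ℝ) (h0 : 0 < η) (h1 : η < 1) : ∃ R : ℕ, ∀ (H : Type)
    [NormedAddCommGroup H] [InnerProductSpace ℂ H] [FiniteDimensional ℂ H]
    (A : Fin n → Module.End ℂ H), (∀ i, (A i).IsSymmetric) →
    ∃ (E E' : Submodule ℂ H) (B : Fin n → Module.End ℂ H), Blk E B ∧ E' ≤ E ∧
      (∀ i, ∀ x ∈ E', B i x = A i x) ∧ (1 - η) * finrank ℂ E ≤ finrank ℂ E' ∧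
      finrank ℂ (WW A R) ≤ 4 ^ (n + 1) * finrank ℂ E := by
  obtain ⟨T, hT⟩ := good_scale n η h0 h1
  choose r hr using piece n
  let R := 2 * T + 2 + ∑ s ∈ Finset.range (T + 1), r s
  refine ⟨R, ?_⟩
  intro H _ _ _ A hA
  obtain ⟨E, E', F, B, ⟨t1, t2, t3, t4, t5, t6⟩, hF⟩ := tiling A hA R η (4 ^ (n + 1)) T
    (by simp only [R]; omega) (by
      intro v hv s hs
      refine hr s H A hA v (WW_anti A ?_ hv)
      have := Finset.single_le_sum (f := r) (fun _ _ => Nat.zero_le _)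
        (Finset.mem_range.2 (show s < T + 1 by omega))
      simp only [R]; omega) 0 (Nat.zero_le _)
  refine ⟨E, E', B, t1, t2, t3, t4, le_trans ?_ t5⟩
  have hbot : WW A R ⊓ Fᗮ = ⊥ := by
    rw [eq_bot_iff]
    rintro v ⟨hv, hvF⟩
    by_contra hv0
    have hv0 : v ≠ 0 := hv0
    obtain ⟨s, hs, hg1, hg2⟩ := hT (fun s => finrank ℂ (VV A v s))
      (fun s t h => Submodule.finrank_mono (VV_mono A v h)) (by
        have : Nontrivial (VV A v 0) :=
          ⟨⟨⟨v, self_mem_VV A v _⟩, 0, fun h => hv0 (congrArg Subtype.val h)⟩⟩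
        exact finrank_pos) (VV_finrank_le A v)
    exact hF v hv hv0 s (Nat.zero_le _) hs ⟨hg1, hg2⟩ fun x hx => inner_eq_zero_symm.1 (hvF x hx)
  have e1 := Submodule.finrank_sup_add_finrank_inf_eq (WW A R) Fᗮ
  rw [hbot, finrank_bot] at e1
  have e2 := Submodule.finrank_add_finrank_orthogonal F
  have e3 := Submodule.finrank_le (WW A R ⊔ Fᗮ)
  omega

end Round
section Final
open Module

lemma quot_ker {V V' : Type} [AddCommGroup V] [Module ℂ V] [AddCommGroup V'] [Module ℂ V']
    (f : V →ₗ[ℂ] V') : finrank ℂ (V ⧸ LinearMap.ker f) = finrank ℂ (LinearMap.range f) :=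
  (f.quotKerEquivRange).finrank_eq

lemma quot_mono {V : Type} [AddCommGroup V] [Module ℂ V] [FiniteDimensional ℂ V]
    {U U' : Submodule ℂ V} (h : U ≤ U') : finrank ℂ (V ⧸ U') ≤ finrank ℂ (V ⧸ U) := by
  have h1 := Submodule.finrank_quotient_add_finrank U
  have h2 := Submodule.finrank_quotient_add_finrank U'
  have h3 := Submodule.finrank_mono h
  omega

lemma quot_inf {V : Type} [AddCommGroup V] [Module ℂ V] [FiniteDimensional ℂ V]
    (U U' : Submodule ℂ V) :
    finrank ℂ (V ⧸ (U ⊓ U')) ≤ finrank ℂ (V ⧸ U) + finrank ℂ (V ⧸ U') := by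
  have h1 := Submodule.finrank_quotient_add_finrank U
  have h2 := Submodule.finrank_quotient_add_finrank U'
  have h3 := Submodule.finrank_quotient_add_finrank (U ⊓ U')
  have h4 := Submodule.finrank_sup_add_finrank_inf_eq U U'
  have h5 := Submodule.finrank_le (U ⊔ U')
  omega

lemma quot_comap {V V' : Type} [AddCommGroup V] [Module ℂ V] [FiniteDimensional ℂ V]
    [AddCommGroup V'] [Module ℂ V'] [FiniteDimensional ℂ V'] (f : V →ₗ[ℂ] V')
    (U : Submodule ℂ V') : finrank ℂ (V ⧸ U.comap f) ≤ finrank ℂ (V' ⧸ U) := by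
  have : U.comap f = LinearMap.ker (U.mkQ ∘ₗ f) := by
    rw [LinearMap.ker_comp, Submodule.ker_mkQ]
  rw [this, quot_ker]
  exact Submodule.finrank_le _

lemma quot_iInf {ι : Type} [Fintype ι] {V : Type} [AddCommGroup V] [Module ℂ V]
    [FiniteDimensional ℂ V] (U : ι → Submodule ℂ V) (m : ℝ)
    (h : ∀ i, (finrank ℂ (V ⧸ U i) : ℝ) ≤ m) :
    (finrank ℂ (V ⧸ ⨅ i, U i) : ℝ) ≤ Fintype.card ι * m := by
  have e1 : ⨅ i, U i = LinearMap.ker (LinearMap.pi fun i => (U i).mkQ) := by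
    rw [LinearMap.ker_pi]; simp
  have e2 : finrank ℂ (V ⧸ ⨅ i, U i) ≤ ∑ i, finrank ℂ (V ⧸ U i) := by
    rw [e1, quot_ker]
    refine (Submodule.finrank_le _).trans ?_
    rw [Module.finrank_pi_fintype]
  calc (finrank ℂ (V ⧸ ⨅ i, U i) : ℝ) ≤ ∑ i, (finrank ℂ (V ⧸ U i) : ℝ) := by exact_mod_cast e2
    _ ≤ ∑ _i : ι, m := Finset.sum_le_sum fun i _ => h i
    _ = _ := by simp

lemma WW_codim {n : ℕ} {H : Type} [NormedAddCommGroup H] [InnerProductSpace ℂ H]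
    [FiniteDimensional ℂ H] (A : Fin n → Module.End ℂ H) (m : ℝ)
    (h : ∀ i j, (finrank ℂ (LinearMap.range (A i * A j - A j * A i)) : ℝ) ≤ m) (R : ℕ) :
    (finrank ℂ (H ⧸ WW A R) : ℝ) ≤ (n + 1) ^ R * (n * (n * m)) := by
  induction R with
  | zero =>
    have e1 : WW A 0 = ⨅ i, ⨅ j, LinearMap.ker (A i * A j - A j * A i) := rfl
    rw [e1, pow_zero, one_mul]
    have := quot_iInf (fun i => ⨅ j, LinearMap.ker (A i * A j - A j * A i)) (n * m) (by
      intro i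
      have := quot_iInf (fun j => LinearMap.ker (A i * A j - A j * A i)) m (by
        intro j; rw [quot_ker]; exact h i j)
      simpa using this)
    simpa using this
  | succ R ih =>
    have e1 : WW A (R + 1) = WW A R ⊓ ⨅ i, (WW A R).comap (A i) := rfl
    rw [e1]
    have e2 := quot_inf (WW A R) (⨅ i, (WW A R).comap (A i))
    have e2' : (finrank ℂ (H ⧸ (WW A R ⊓ ⨅ i, (WW A R).comap (A i))) : ℝ) ≤
      finrank ℂ (H ⧸ WW A R) + finrank ℂ (H ⧸ ⨅ i, (WW A R).comap (A i)) := by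
      exact_mod_cast e2
    have e3 := quot_iInf (fun i => (WW A R).comap (A i)) ((n + 1) ^ R * (n * (n * m))) (by
      intro i
      refine le_trans ?_ ih
      exact_mod_cast quot_comap (A i) (WW A R))
    rw [Fintype.card_fin] at e3
    calc _ ≤ _ := e2'
      _ ≤ (n + 1) ^ R * (n * (n * m)) + n * ((n + 1) ^ R * (n * (n * m))) := add_le_add ih e3
      _ = _ := by ring

lemma main_step {n : ℕ} {H : Type} [NormedAddCommGroup H] [InnerProductSpace ℂ H]
    [FiniteDimensional ℂ H] (A : Fin n → Module.End ℂ H) (hA : ∀ i, (A i).IsSymmetric)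
    (E E' : Submodule ℂ H) (B : Fin n → Module.End ℂ H) (hB : Blk E B) (hE : E' ≤ E)
    (hBA : ∀ i, ∀ x ∈ E', B i x = A i x) :
    ∃ A' : Fin n → Module.End ℂ Eᗮ, (∀ i, (A' i).IsSymmetric) ∧
      (∀ i j, finrank ℂ (LinearMap.range (A' i * A' j - A' j * A' i)) ≤
        2 * (finrank ℂ E - finrank ℂ E') +
          finrank ℂ (LinearMap.range (A i * A j - A j * A i))) ∧
      ∀ B' : Fin n → Module.End ℂ Eᗮ, (∀ i j, B' i * B' j = B' j * B' i) →
        ∃ B'' : Fin n → Module.End ℂ H, (∀ i j, B'' i * B'' j = B'' j * B'' i) ∧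
        ∀ i, finrank ℂ (LinearMap.range (A i - B'' i)) ≤ 2 * (finrank ℂ E - finrank ℂ E') +
          finrank ℂ (LinearMap.range (A' i - B' i)) := by
  let Q : H →ₗ[ℂ] Eᗮ := Eᗮ.orthogonalProjectionOnto.toLinearMap
  have hQ : ∀ x : Eᗮ, Q x = x := fun x => Eᗮ.orthogonalProjectionOnto_mem_subspace_eq_self x
  let P : H →ₗ[ℂ] E := E.orthogonalProjectionOnto.toLinearMap
  have hPQ : ∀ x : H, (P x : H) + Q x = x := fun x =>
    E.starProjection_add_starProjection_orthogonal x
  have hQin : ∀ (x : H) (y : Eᗮ), inner ℂ (Q x : H) (y : H) = inner ℂ x (y : H) := by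
    intro x y
    conv_rhs => rw [← hPQ x]
    rw [inner_add_left, y.2 _ (P x).2, zero_add]
  have hQin' : ∀ (x : H) (y : Eᗮ), inner ℂ (y : H) (Q x : H) = inner ℂ (y : H) x := by
    intro x y
    rw [← inner_conj_symm, hQin, inner_conj_symm]
  let g (i : Fin n) : Eᗮ →ₗ[ℂ] E := P ∘ₗ A i ∘ₗ Eᗮ.subtype
  have hg : ∀ i, finrank ℂ (Eᗮ ⧸ LinearMap.ker (g i)) ≤ finrank ℂ E - finrank ℂ E' := by
    intro i
    rw [quot_ker]
    have e1 : finrank ℂ (LinearMap.range (g i)) =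
        finrank ℂ ((LinearMap.range (g i)).map E.subtype) :=
      (LinearEquiv.finrank_eq (Submodule.equivMapOfInjective _ E.injective_subtype _))
    have e2 : (LinearMap.range (g i)).map E.subtype ≤ E'ᗮ ⊓ E := by
      rintro _ ⟨_, ⟨u, rfl⟩, rfl⟩
      refine ⟨?_, (g i u).2⟩
      intro x hx
      have h1 : inner ℂ x (A i u) = 0 := by
        rw [← hA i x u, ← hBA i x hx]
        exact u.2 _ (hB.1 i x)
      rw [← hPQ (A i u), inner_add_right, (Q (A i u)).2 x (hE hx), add_zero] at h1
      exact h1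
    have e3 := Submodule.finrank_mono e2
    have e4 := Submodule.finrank_add_inf_finrank_orthogonal hE
    omega
  have hgk : ∀ i (u : Eᗮ), u ∈ LinearMap.ker (g i) → (Q (A i u) : H) = A i u := by
    intro i u hu
    have h1 : P (A i u) = 0 := hu
    have h2 := hPQ (A i u)
    rw [h1] at h2
    simpa using h2
  let A' (i : Fin n) : Module.End ℂ Eᗮ := Q ∘ₗ A i ∘ₗ Eᗮ.subtype
  have hA' : ∀ i u, A' i u = Q (A i u) := fun i u => rfl
  refine ⟨A', ?_, ?_, ?_⟩
  · intro i x y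
    rw [Submodule.coe_inner, Submodule.coe_inner, hA', hA', hQin, hQin', hA i]
  · intro i j
    rw [← quot_ker]
    let K := LinearMap.ker (A i * A j - A j * A i)
    have hle : (LinearMap.ker (g i) ⊓ LinearMap.ker (g j)) ⊓ K.comap Eᗮ.subtype ≤
        LinearMap.ker (A' i * A' j - A' j * A' i) := by
      rintro u ⟨⟨h1, h2⟩, h3⟩
      have h3' : (A i * A j - A j * A i) (u : H) = 0 := h3
      rw [LinearMap.sub_apply, Module.End.mul_apply, Module.End.mul_apply, sub_eq_zero] at h3'
      rw [LinearMap.mem_ker, LinearMap.sub_apply, Module.End.mul_apply, Module.End.mul_apply,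
        sub_eq_zero, hA', hA' i u, hA' j (Q _), hA' j u, hgk i u h1, hgk j u h2, h3']
    have e1 := quot_mono hle
    have e2 := quot_inf (LinearMap.ker (g i) ⊓ LinearMap.ker (g j)) (K.comap Eᗮ.subtype)
    have e3 := quot_inf (LinearMap.ker (g i)) (LinearMap.ker (g j))
    have e4 := quot_comap Eᗮ.subtype K
    have e5 : finrank ℂ (H ⧸ K) = finrank ℂ (LinearMap.range (A i * A j - A j * A i)) :=
      quot_ker _
    have e6 := hg i
    have e7 := hg j
    omega
  · intro B' hB'
    obtain ⟨D, hD1, hD2⟩ := Blk.ofEnd Eᗮ B' hB'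
    refine ⟨fun i => B i + D i, (hB.add hD1 fun x hx y hy => hy x hx).2.2, ?_⟩
    intro i
    let M : Module.End ℂ H := A i - (B i + D i)
    have hsup : LinearMap.range M ≤
        LinearMap.range (M ∘ₗ E.subtype) ⊔ LinearMap.range (M ∘ₗ Eᗮ.subtype) := by
      rintro _ ⟨x, rfl⟩
      rw [← hPQ x, map_add]
      exact Submodule.add_mem_sup ⟨P x, rfl⟩ ⟨Q x, rfl⟩
    have e1 := Submodule.finrank_mono hsup
    have e2 := Submodule.finrank_add_le_finrank_add_finrank
      (LinearMap.range (M ∘ₗ E.subtype)) (LinearMap.range (M ∘ₗ Eᗮ.subtype))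
    have e3 : finrank ℂ (LinearMap.range (M ∘ₗ E.subtype)) ≤ finrank ℂ E - finrank ℂ E' := by
      have h1 := LinearMap.finrank_range_add_finrank_ker (M ∘ₗ E.subtype)
      have h2 : E'.comap E.subtype ≤ LinearMap.ker (M ∘ₗ E.subtype) := by
        intro x hx
        have hx' : (x : H) ∈ E' := hx
        have h3 : D i x = 0 := hD1.2.1 i x (E.le_orthogonal_orthogonal x.2)
        change A i x - (B i x + D i x) = 0
        rw [h3, hBA i x hx', add_zero, sub_self]
      have h3 := Submodule.finrank_mono h2
      have h4 : finrank ℂ (E'.comap E.subtype) = finrank ℂ E' :=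
        (Submodule.comapSubtypeEquivOfLe hE).finrank_eq
      omega
    have e4 : finrank ℂ (LinearMap.range (M ∘ₗ Eᗮ.subtype)) ≤
        (finrank ℂ E - finrank ℂ E') + finrank ℂ (LinearMap.range (A' i - B' i)) := by
      rw [← quot_ker, ← quot_ker]
      have hle : LinearMap.ker (g i) ⊓ LinearMap.ker (A' i - B' i) ≤
          LinearMap.ker (M ∘ₗ Eᗮ.subtype) := by
        rintro u ⟨h1, h2⟩
        rw [SetLike.mem_coe, LinearMap.mem_ker, LinearMap.sub_apply, sub_eq_zero] at h2
        change A i u - (B i u + D i u) = 0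
        rw [hB.2.1 i u u.2, hD2 i u, ← h2, hA', hgk i u h1, zero_add, sub_self]
      have h1 := quot_mono hle
      have h2 := quot_inf (LinearMap.ker (g i)) (LinearMap.ker (A' i - B' i))
      have h3 := hg i
      omega
    change finrank ℂ (LinearMap.range M) ≤ _
    omega

lemma main_ind (n : ℕ) (k : ℕ) : ∀ ε : ℝ, 0 < ε → ∃ δ : ℝ, 0 < δ ∧ ∀ (H : Type)
    [NormedAddCommGroup H] [InnerProductSpace ℂ H] [FiniteDimensional ℂ H]
    (A : Fin n → Module.End ℂ H), (∀ i, (A i).IsSymmetric) → ∀ N : ℝ, (finrank ℂ H : ℝ) ≤ N →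
    (∀ i j, (finrank ℂ (LinearMap.range (A i * A j - A j * A i)) : ℝ) ≤ δ * N) →
    ∃ B : Fin n → Module.End ℂ H, (∀ i j, B i * B j = B j * B i) ∧
      ∀ i, (finrank ℂ (LinearMap.range (A i - B i)) : ℝ) ≤
        ε * N + (1 - 1 / (2 * 4 ^ (n + 1))) ^ k * finrank ℂ H := by
  have hc1 : (1 : ℝ) / (2 * 4 ^ (n + 1)) ≤ 1 := by
    rw [div_le_one (by positivity)]
    have : (1 : ℝ) ≤ 4 ^ (n + 1) := one_le_pow₀ (by norm_num)
    linarith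
  have hrk : ∀ (H : Type) [NormedAddCommGroup H] [InnerProductSpace ℂ H] [FiniteDimensional ℂ H]
    (f : Module.End ℂ H), (finrank ℂ (LinearMap.range f) : ℝ) ≤ finrank ℂ H := by
    intro H _ _ _ f
    exact_mod_cast Submodule.finrank_le _
  induction k with
  | zero =>
    intro ε hε
    refine ⟨1, one_pos, ?_⟩
    intro H _ _ _ A hA N hN _
    refine ⟨0, fun i j => rfl, fun i => ?_⟩
    have h1 := hrk H (A i - 0)
    have h2 : (0 : ℝ) ≤ finrank ℂ H := Nat.cast_nonneg _
    have h3 : 0 ≤ ε * N := mul_nonneg hε.le (h2.trans hN)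
    rw [pow_zero, one_mul]
    exact h1.trans (by linarith)
  | succ k ih =>
    intro ε hε
    obtain ⟨δ₁, hδ₁, ih⟩ := ih (ε / 2) (by positivity)
    let η : ℝ := min (1 / 2) (min (ε / 4) (δ₁ / 4))
    have hη0 : 0 < η := by simp only [η]; positivity
    have hη1 : η ≤ 1 / 2 := min_le_left _ _
    have hη2 : η ≤ ε / 4 := (min_le_right _ _).trans (min_le_left _ _)
    have hη3 : η ≤ δ₁ / 4 := (min_le_right _ _).trans (min_le_right _ _)
    obtain ⟨R, hR⟩ := round_exists n η hη0 (by linarith)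
    let K : ℝ := (n + 1) ^ R * (n * n)
    have hK : 0 ≤ K := by simp only [K]; positivity
    let δ : ℝ := min (δ₁ / 2) (ε / (2 * (K + 1)))
    have hδ0 : 0 < δ := by simp only [δ]; positivity
    have hδ1 : δ ≤ δ₁ / 2 := min_le_left _ _
    have hδ2 : K * δ ≤ ε / 2 := by
      have : δ ≤ ε / (2 * (K + 1)) := min_le_right _ _
      rw [le_div_iff₀ (by positivity)] at this
      nlinarith
    refine ⟨δ, hδ0, ?_⟩
    intro H _ _ _ A hA N hN hcomm
    have hH0 : (0 : ℝ) ≤ finrank ℂ H := Nat.cast_nonneg _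
    have hN0 : 0 ≤ N := hH0.trans hN
    have hp : (0 : ℝ) ≤ (1 - 1 / (2 * 4 ^ (n + 1))) ^ k := pow_nonneg (by linarith) _
    have hp1 : (0 : ℝ) ≤ (1 - 1 / (2 * 4 ^ (n + 1))) ^ (k + 1) := pow_nonneg (by linarith) _
    by_cases hsmall : (finrank ℂ H : ℝ) ≤ ε * N
    · refine ⟨0, fun i j => rfl, fun i => ?_⟩
      have h1 := hrk H (A i - 0)
      have := mul_nonneg hp1 hH0
      exact h1.trans (by linarith)
    push Not at hsmall
    obtain ⟨E, E', B, hB, hE, hBA, hd, hW⟩ := hR H A hA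
    have hcod := WW_codim A (δ * N) hcomm R
    have hq := Submodule.finrank_quotient_add_finrank (WW A R)
    have hq' : (finrank ℂ (H ⧸ WW A R) : ℝ) + finrank ℂ (WW A R) = finrank ℂ H := by
      exact_mod_cast hq
    have hW' : (finrank ℂ (WW A R) : ℝ) ≤ 4 ^ (n + 1) * finrank ℂ E := by exact_mod_cast hW
    have hcod2 : (finrank ℂ (H ⧸ WW A R) : ℝ) ≤ finrank ℂ H / 2 := by
      calc _ ≤ _ := hcod
        _ = K * δ * N := by simp only [K]; ring
        _ ≤ ε / 2 * N := mul_le_mul_of_nonneg_right hδ2 hN0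
        _ ≤ _ := by linarith
    have hEbig : 1 / (2 * 4 ^ (n + 1)) * (finrank ℂ H : ℝ) ≤ finrank ℂ E := by
      rw [div_mul_eq_mul_div, div_le_iff₀ (by positivity)]
      linarith
    have hEE : ((finrank ℂ E - finrank ℂ E' : ℕ) : ℝ) ≤ η * N := by
      rw [Nat.cast_sub (Submodule.finrank_mono hE)]
      have h1 : (finrank ℂ E : ℝ) ≤ finrank ℂ H := by exact_mod_cast Submodule.finrank_le E
      have := mul_le_mul_of_nonneg_left (h1.trans hN) hη0.le
      linarith
    have hG : (finrank ℂ E : ℝ) + finrank ℂ Eᗮ = finrank ℂ H := by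
      exact_mod_cast Submodule.finrank_add_finrank_orthogonal E
    obtain ⟨A', hA', hcomm', hfin⟩ := main_step A hA E E' B hB hE hBA
    obtain ⟨B', hB', hB'A⟩ := ih Eᗮ A' hA' N (by
        have : (0 : ℝ) ≤ finrank ℂ E := Nat.cast_nonneg _
        linarith) (by
      intro i j
      have h1 : (finrank ℂ (LinearMap.range (A' i * A' j - A' j * A' i)) : ℝ) ≤
        2 * ((finrank ℂ E - finrank ℂ E' : ℕ) : ℝ) +
          finrank ℂ (LinearMap.range (A i * A j - A j * A i)) := by exact_mod_cast hcomm' i j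
      have h2 := hcomm i j
      have h3 := mul_le_mul_of_nonneg_right hη3 hN0
      have h4 := mul_le_mul_of_nonneg_right hδ1 hN0
      linarith)
    obtain ⟨B'', hB'', hfinal⟩ := hfin B' hB'
    refine ⟨B'', hB'', fun i => ?_⟩
    have h1 : (finrank ℂ (LinearMap.range (A i - B'' i)) : ℝ) ≤
      2 * ((finrank ℂ E - finrank ℂ E' : ℕ) : ℝ) +
          finrank ℂ (LinearMap.range (A' i - B' i)) := by exact_mod_cast hfinal i
    have h2 := hB'A i
    have h3 := mul_le_mul_of_nonneg_right hη2 hN0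
    have h4 : (finrank ℂ Eᗮ : ℝ) ≤ (1 - 1 / (2 * 4 ^ (n + 1))) * finrank ℂ H := by
      rw [sub_mul, one_mul]; linarith
    have h5 := mul_le_mul_of_nonneg_left h4 hp
    rw [← mul_assoc, ← pow_succ] at h5
    linarith

lemma main_ops (n : ℕ) (ε : ℝ) (hε : 0 < ε) : ∃ δ : ℝ, 0 < δ ∧ ∀ (H : Type)
    [NormedAddCommGroup H] [InnerProductSpace ℂ H] [FiniteDimensional ℂ H]
    (A : Fin n → Module.End ℂ H), (∀ i, (A i).IsSymmetric) →
    (∀ i j, (finrank ℂ (LinearMap.range (A i * A j - A j * A i)) : ℝ) ≤ δ * finrank ℂ H) →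
    ∃ B : Fin n → Module.End ℂ H, (∀ i j, B i * B j = B j * B i) ∧
      ∀ i, (finrank ℂ (LinearMap.range (A i - B i)) : ℝ) ≤ ε * finrank ℂ H := by
  obtain ⟨k, hk⟩ := exists_pow_lt_of_lt_one (show 0 < ε / 2 by positivity)
    (show (1 : ℝ) - 1 / (2 * 4 ^ (n + 1)) < 1 by
      have : (0 : ℝ) < 1 / (2 * 4 ^ (n + 1)) := by positivity
      linarith)
  obtain ⟨δ, hδ, h⟩ := main_ind n k (ε / 2) (by positivity)
  refine ⟨δ, hδ, ?_⟩
  intro H _ _ _ A hA hc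
  obtain ⟨B, hB, hBA⟩ := h H A hA _ le_rfl hc
  refine ⟨B, hB, fun i => (hBA i).trans ?_⟩
  have : (0 : ℝ) ≤ finrank ℂ H := Nat.cast_nonneg _
  have := mul_le_mul_of_nonneg_right hk.le this
  linarith

end Final
section Matr
open scoped ComplexOrder
open Module

lemma mrank_add {d : ℕ} (M N : Matrix (Fin d) (Fin d) ℂ) : (M + N).rank ≤ M.rank + N.rank := by
  unfold Matrix.rank
  have h : LinearMap.range (M + N).mulVecLin ≤ LinearMap.range M.mulVecLin ⊔ LinearMap.range N.mulVecLin := by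
    rintro _ ⟨v, rfl⟩
    rw [Matrix.mulVecLin_add, LinearMap.add_apply]
    exact Submodule.add_mem_sup ⟨v, rfl⟩ ⟨v, rfl⟩
  exact (Submodule.finrank_mono h).trans (Submodule.finrank_add_le_finrank_add_finrank _ _)

lemma mrank_smul {d : ℕ} (c : ℂ) (M : Matrix (Fin d) (Fin d) ℂ) : (c • M).rank ≤ M.rank := by
  have : c • M = (c • (1 : Matrix (Fin d) (Fin d) ℂ)) * M := by simp
  rw [this]
  exact Matrix.rank_mul_le_right _ _

lemma mrank_neg {d : ℕ} (M : Matrix (Fin d) (Fin d) ℂ) : (-M).rank ≤ M.rank := by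
  have := mrank_smul (-1) M
  simpa using this

lemma comm_star {d : ℕ} (P Q : Matrix (Fin d) (Fin d) ℂ)
    (hP : (Pᴴ * P = 1 ∧ P * Pᴴ = 1) ∨ P.IsHermitian) :
    (Pᴴ * Q - Q * Pᴴ).rank ≤ (P * Q - Q * P).rank := by
  rcases hP with ⟨h1, h2⟩ | h
  · have : Pᴴ * Q - Q * Pᴴ = Pᴴ * (-(P * Q - Q * P) * Pᴴ) := by
      have e : Pᴴ * (-(P * Q - Q * P) * Pᴴ) = Pᴴ * Q * (P * Pᴴ) - (Pᴴ * P) * Q * Pᴴ := by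
        noncomm_ring
      rw [e, h1, h2]; simp
    rw [this]
    exact (Matrix.rank_mul_le_right _ _).trans ((Matrix.rank_mul_le_left _ _).trans (mrank_neg _))
  · rw [h.eq]

lemma comm_combo {d : ℕ} (P Q : Matrix (Fin d) (Fin d) ℂ)
    (hP : (Pᴴ * P = 1 ∧ P * Pᴴ = 1) ∨ P.IsHermitian)
    (hQ : (Qᴴ * Q = 1 ∧ Q * Qᴴ = 1) ∨ Q.IsHermitian) (a b c e : ℂ) :
    ((a • P + b • Pᴴ) * (c • Q + e • Qᴴ) - (c • Q + e • Qᴴ) * (a • P + b • Pᴴ)).rank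
      ≤ 4 * (P * Q - Q * P).rank := by
  have key : (a • P + b • Pᴴ) * (c • Q + e • Qᴴ) - (c • Q + e • Qᴴ) * (a • P + b • Pᴴ)
      = (a * c) • (P * Q - Q * P) + (b * c) • (Pᴴ * Q - Q * Pᴴ)
        + (-(a * e)) • (Qᴴ * P - P * Qᴴ) + (-(b * e)) • (P * Q - Q * P)ᴴ := by
    simp only [Matrix.conjTranspose_sub, Matrix.conjTranspose_mul, mul_add, add_mul,
      Matrix.smul_mul, Matrix.mul_smul, smul_smul, smul_sub, neg_smul, mul_comm c, mul_comm e]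
    abel
  rw [key]
  have h1 := mrank_smul (a * c) (P * Q - Q * P)
  have h2 := (mrank_smul (b * c) _).trans (comm_star P Q hP)
  have h3 := (mrank_smul (-(a * e)) _).trans (comm_star Q P hQ)
  have h3' : (Q * P - P * Q).rank ≤ (P * Q - Q * P).rank := by
    have := mrank_neg (P * Q - Q * P)
    rwa [neg_sub] at this
  have h4 := mrank_smul (-(b * e)) (P * Q - Q * P)ᴴ
  rw [Matrix.rank_conjTranspose] at h4
  have := mrank_add ((a * c) • (P * Q - Q * P) + (b * c) • (Pᴴ * Q - Q * Pᴴ)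
        + (-(a * e)) • (Qᴴ * P - P * Qᴴ)) ((-(b * e)) • (P * Q - Q * P)ᴴ)
  have := mrank_add ((a * c) • (P * Q - Q * P) + (b * c) • (Pᴴ * Q - Q * Pᴴ))
        ((-(a * e)) • (Qᴴ * P - P * Qᴴ))
  have := mrank_add ((a * c) • (P * Q - Q * P)) ((b * c) • (Pᴴ * Q - Q * Pᴴ))
  omega

lemma main_herm (n : ℕ) (ε : ℝ) (hε : 0 < ε) : ∃ δ : ℝ, 0 < δ ∧
    ∀ (d : ℕ) (A : Fin n → Matrix (Fin d) (Fin d) ℂ), (∀ i, (A i).IsHermitian) →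
      (∀ i j, ((A i * A j - A j * A i).rank : ℝ) ≤ δ * d) →
      ∃ B : Fin n → Matrix (Fin d) (Fin d) ℂ, (∀ i j, B i * B j = B j * B i) ∧
        ∀ i, ((A i - B i).rank : ℝ) ≤ ε * d := by
  obtain ⟨δ, hδ, H⟩ := main_ops n ε hε
  refine ⟨δ, hδ, fun d A hA hc => ?_⟩
  let b := (EuclideanSpace.basisFun (Fin d) ℂ).toBasis
  let φ := Matrix.toLinAlgEquiv b
  have hφ : ∀ M : Matrix (Fin d) (Fin d) ℂ, finrank ℂ (LinearMap.range (φ M)) = M.rank := fun M =>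
    (Matrix.rank_eq_finrank_range_toLin M b b).symm
  have hfd : finrank ℂ (EuclideanSpace ℂ (Fin d)) = d := by simp
  obtain ⟨B, hB, hAB⟩ := H (EuclideanSpace ℂ (Fin d)) (fun i => φ (A i))
    (fun i => by
      have := Matrix.isSymmetric_toEuclideanLin_iff.mpr (hA i)
      rw [Matrix.toEuclideanLin_eq_toLin_orthonormal] at this
      exact this)
    (fun i j => by
      have := hc i j
      rw [hfd, ← map_mul, ← map_mul, ← map_sub, hφ]
      exact this)
  refine ⟨fun i => φ.symm (B i), fun i j => ?_, fun i => ?_⟩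
  · rw [← map_mul, ← map_mul, hB]
  · have := hAB i
    rw [hfd] at this
    rw [← hφ, map_sub, AlgEquiv.apply_symm_apply]
    exact this

end Matr

/-- **Theorem (main).** For every `ε > 0` and `n ∈ ℕ₊` there exists `δ > 0` such that for all
`d ∈ ℕ₊`: if `A₁, …, Aₙ` are `d×d` complex matrices, each either unitary or self-adjoint,
which pairwise `δ`-almost commute in rank, then there are pairwise commuting matrices
`B₁, …, Bₙ` with `rank(Aᵢ - Bᵢ) ≤ ε` for all `i`. -/
theorem almost_commuting_matrices_rank_metric
    (ε : ℝ) (hε : 0 < ε) (n : ℕ) (hn : 0 < n) :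
    ∃ δ : ℝ, 0 < δ ∧
      ∀ (d : ℕ), 0 < d →
        ∀ A : Fin n → Matrix (Fin d) (Fin d) ℂ,
          (∀ i, ((A i)ᴴ * A i = 1 ∧ A i * (A i)ᴴ = 1) ∨ (A i).IsHermitian) →
          (∀ i j, nrank (A i * A j - A j * A i) ≤ δ) →
          ∃ B : Fin n → Matrix (Fin d) (Fin d) ℂ,
            (∀ i j, B i * B j = B j * B i) ∧
            ∀ i, nrank (A i - B i) ≤ ε := by

  obtain ⟨δ, hδ, H⟩ := main_herm (n + n) (ε / 2) (by positivity)
  refine ⟨δ / 4, by positivity, fun d hd A hA hc => ?_⟩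
  have hd' : (0 : ℝ) < d := by exact_mod_cast hd
  let X : Fin n → Matrix (Fin d) (Fin d) ℂ := fun i => (1 / 2 : ℂ) • A i + (1 / 2 : ℂ) • (A i)ᴴ
  let Y : Fin n → Matrix (Fin d) (Fin d) ℂ := fun i =>
    (-Complex.I / 2) • A i + (Complex.I / 2) • (A i)ᴴ
  have hAXY : ∀ i, A i = X i + Complex.I • Y i := by
    intro i
    have e1 : Complex.I * (-Complex.I / 2) = 1 / 2 := by
      linear_combination (-1 / 2) * Complex.I_mul_I
    have e2 : Complex.I * (Complex.I / 2) = -(1 / 2) := by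
      linear_combination (1 / 2) * Complex.I_mul_I
    simp only [X, Y, smul_add, smul_smul, e1, e2]
    module
  have hC : ∀ k, ∃ (i : Fin n) (a b : ℂ), Fin.append X Y k = a • A i + b • (A i)ᴴ := by
    intro k
    refine Fin.addCases (fun i => ?_) (fun i => ?_) k
    · exact ⟨i, _, _, by rw [Fin.append_left]⟩
    · exact ⟨i, _, _, by rw [Fin.append_right]⟩
  obtain ⟨B, hB, hAB⟩ := H d (Fin.append X Y)
    (fun k => by
      refine Fin.addCases (fun i => ?_) (fun i => ?_) k
      · rw [Fin.append_left]
        simp only [X, Matrix.IsHermitian, Matrix.conjTranspose_add, Matrix.conjTranspose_smul,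
          Matrix.conjTranspose_conjTranspose]
        simp [add_comm]
      · rw [Fin.append_right]
        simp only [Y, Matrix.IsHermitian, Matrix.conjTranspose_add, Matrix.conjTranspose_smul,
          Matrix.conjTranspose_conjTranspose]
        simp [add_comm])
    (fun k l => by
      obtain ⟨i, a, b, h1⟩ := hC k
      obtain ⟨j, c, e, h2⟩ := hC l
      rw [h1, h2]
      have h3 := comm_combo (A i) (A j) (hA i) (hA j) a b c e
      have h4 := hc i j
      unfold nrank at h4
      rw [div_le_iff₀ hd'] at h4
      have h5 : ((((a • A i + b • (A i)ᴴ) * (c • A j + e • (A j)ᴴ) -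
        (c • A j + e • (A j)ᴴ) * (a • A i + b • (A i)ᴴ)).rank : ℕ) : ℝ)
          ≤ 4 * ((A i * A j - A j * A i).rank : ℝ) := by exact_mod_cast h3
      linarith)
  refine ⟨fun i => B (Fin.castAdd n i) + Complex.I • B (Fin.natAdd n i), fun i j => ?_,
    fun i => ?_⟩
  · simp only [mul_add, add_mul, Matrix.smul_mul, Matrix.mul_smul]
    rw [hB (Fin.castAdd n i) (Fin.castAdd n j), hB (Fin.castAdd n i) (Fin.natAdd n j),
      hB (Fin.natAdd n i) (Fin.castAdd n j), hB (Fin.natAdd n i) (Fin.natAdd n j)]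
    abel
  · have h1 := hAB (Fin.castAdd n i)
    have h2 := hAB (Fin.natAdd n i)
    rw [Fin.append_left] at h1
    rw [Fin.append_right] at h2
    unfold nrank
    rw [div_le_iff₀ hd']
    have e : A i - (B (Fin.castAdd n i) + Complex.I • B (Fin.natAdd n i))
        = (X i - B (Fin.castAdd n i)) + Complex.I • (Y i - B (Fin.natAdd n i)) := by
      rw [smul_sub]
      nth_rewrite 1 [hAXY i]
      abel
    have h3 := mrank_add (X i - B (Fin.castAdd n i)) (Complex.I • (Y i - B (Fin.natAdd n i)))
    have h4 := mrank_smul Complex.I (Y i - B (Fin.natAdd n i))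
    have h5 : ((X i - B (Fin.castAdd n i) + Complex.I • (Y i - B (Fin.natAdd n i))).rank : ℝ)
        ≤ (X i - B (Fin.castAdd n i)).rank + (Y i - B (Fin.natAdd n i)).rank := by
      exact_mod_cast h3.trans (Nat.add_le_add_left h4 _)
    rw [e]
    linarith
end

section
/- For every n ∈ ℕ₊ there exists an increasing function K : ℕ → ℕ with the following properties. Let f, f₁, …, f_k ∈ ℂ[X₁, …, Xₙ] be polynomials of degree at most R, and let 𝔞 be the ideal generated by f₁, …, f_k. (1) If f ∈ 𝔞, then there exist h₁, …, h_k ∈ ℂ[X₁, …, Xₙ] such that h₁f₁ + ⋯ + h_k f_k = f and deg(hᵢfᵢ) ≤ K(R) for all i. (2) If f ∈ rad(𝔞), then there exist m ∈ ℕ and g₁, …, g_k ∈ ℂ[X₁, …, Xₙ] such that g₁f₁ + ⋯ + g_k f_k = f^m and deg(gᵢfᵢ) ≤ K(R) for all i. -/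
open MvPolynomial

namespace EffNull

variable {n : ℕ}

/-- the graded lexicographic order -/
noncomputable abbrev ord (n : ℕ) : MonomialOrder (Fin n) := MonomialOrder.degLex

/-- Span of monomial multiples of elements of `G` whose support lies in `Q`. -/
noncomputable def U (G : Set (MvPolynomial (Fin n) ℂ)) (Q : Set (ord n).syn) :
    Submodule ℂ (MvPolynomial (Fin n) ℂ) :=
  Submodule.span ℂ {p | (∃ a, ∃ g ∈ G, p = monomial a (1 : ℂ) * g) ∧
    ∀ e ∈ p.support, (ord n).toSyn e ∈ Q}

lemma U_mono (G : Set (MvPolynomial (Fin n) ℂ)) {Q Q' : Set (ord n).syn} (h : Q ⊆ Q') :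
    U G Q ≤ U G Q' := by
  apply Submodule.span_mono
  rintro p ⟨hp, hs⟩
  exact ⟨hp, fun e he => h (hs e he)⟩

lemma U_lt (G : Set (MvPolynomial (Fin n) ℂ)) (s : (ord n).syn) (f : MvPolynomial (Fin n) ℂ)
    (hf : f ∈ U G (Set.Iio s)) : f = 0 ∨ ∃ s' < s, f ∈ U G (Set.Iic s') := by
  induction hf using Submodule.span_induction with
  | mem p hp =>
    by_cases h0 : p = 0
    · exact Or.inl h0
    · right
      refine ⟨(ord n).toSyn ((ord n).degree p), hp.2 _ (MonomialOrder.degree_mem_support (m := ord n) h0), ?_⟩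
      exact Submodule.subset_span ⟨hp.1, fun e he => Set.mem_Iic.2 (MonomialOrder.le_degree he)⟩
  | zero => exact Or.inl rfl
  | add x y _ _ hx hy =>
    rcases hx with rfl | ⟨s1, h1, hx⟩
    · simpa using hy
    rcases hy with rfl | ⟨s2, h2, hy⟩
    · right; exact ⟨s1, h1, by simpa using hx⟩
    right
    exact ⟨max s1 s2, max_lt h1 h2, Submodule.add_mem _
      (U_mono G (Set.Iic_subset_Iic.2 (le_max_left _ _)) hx)
      (U_mono G (Set.Iic_subset_Iic.2 (le_max_right _ _)) hy)⟩
  | smul c x _ hx =>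
    rcases hx with rfl | ⟨s1, h1, hx⟩
    · simp
    · right; exact ⟨s1, h1, Submodule.smul_mem _ _ hx⟩

lemma mem_support_monomial_mul {a e : Fin n →₀ ℕ} {p : MvPolynomial (Fin n) ℂ}
    (h : e ∈ (monomial a (1 : ℂ) * p).support) : ∃ e' ∈ p.support, e = a + e' := by
  rw [mem_support_iff, coeff_monomial_mul'] at h
  split_ifs at h with h1
  · refine ⟨e - a, by simpa using h, ?_⟩
    rw [add_tsub_cancel_of_le h1]
  · exact absurd rfl h

lemma U_shift (G : Set (MvPolynomial (Fin n) ℂ)) (c : Fin n →₀ ℕ) (w : Fin n →₀ ℕ)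
    (f : MvPolynomial (Fin n) ℂ) (hf : f ∈ U G (Set.Iio ((ord n).toSyn w))) :
    monomial c (1 : ℂ) * f ∈ U G (Set.Iio ((ord n).toSyn (c + w))) := by
  induction hf using Submodule.span_induction with
  | mem p hp =>
    apply Submodule.subset_span
    obtain ⟨⟨a, g, hg, rfl⟩, hs⟩ := hp
    refine ⟨⟨c + a, g, hg, ?_⟩, ?_⟩
    · rw [← mul_assoc, monomial_mul, one_mul]
    · intro e he
      obtain ⟨e', he', rfl⟩ := mem_support_monomial_mul he
      have := hs e' he'
      simp only [Set.mem_Iio, map_add] at this ⊢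
      exact (add_lt_add_iff_left _).2 this
  | zero => simp
  | add x y _ _ hx hy => rw [mul_add]; exact Submodule.add_mem _ hx hy
  | smul r x _ hx => rw [mul_smul_comm]; exact Submodule.smul_mem _ _ hx

lemma support_lt_of_coeff_eq_zero {p : MvPolynomial (Fin n) ℂ} {m : Fin n →₀ ℕ}
    (h : ∀ e ∈ p.support, (ord n).toSyn e ∈ Set.Iic ((ord n).toSyn m)) (h0 : coeff m p = 0) :
    ∀ e ∈ p.support, (ord n).toSyn e ∈ Set.Iio ((ord n).toSyn m) := by
  intro e he
  refine Set.mem_Iio.2 (lt_of_le_of_ne (Set.mem_Iic.1 (h e he)) ?_)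
  intro h1
  have := (ord n).toSyn.injective h1
  subst this
  exact (mem_support_iff.1 he) h0

/-- Cancellation step. -/
lemma U_step (G : Set (MvPolynomial (Fin n) ℂ)) (m : Fin n →₀ ℕ)
    (H : ∀ a b, ∀ g ∈ G, ∀ g' ∈ G,
      (∀ e ∈ (monomial a (1 : ℂ) * g).support, (ord n).toSyn e ∈ Set.Iic ((ord n).toSyn m)) →
      (∀ e ∈ (monomial b (1 : ℂ) * g').support, (ord n).toSyn e ∈ Set.Iic ((ord n).toSyn m)) →
      coeff m (monomial a (1 : ℂ) * g) ≠ 0 → coeff m (monomial b (1 : ℂ) * g') ≠ 0 →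
      monomial a (1 : ℂ) * g - (coeff m (monomial a (1 : ℂ) * g) /
        coeff m (monomial b (1 : ℂ) * g')) • (monomial b (1 : ℂ) * g') ∈
          U G (Set.Iio ((ord n).toSyn m)))
    (f : MvPolynomial (Fin n) ℂ) (hf : f ∈ U G (Set.Iic ((ord n).toSyn m)))
    (h0 : coeff m f = 0) : f ∈ U G (Set.Iio ((ord n).toSyn m)) := by
  by_cases hex : ∃ b, ∃ g' ∈ G, (∀ e ∈ (monomial b (1 : ℂ) * g').support,
      (ord n).toSyn e ∈ Set.Iic ((ord n).toSyn m)) ∧ coeff m (monomial b (1 : ℂ) * g') ≠ 0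
  · obtain ⟨b, g', hg', hs', hc'⟩ := hex
    suffices h : f - (coeff m f / coeff m (monomial b (1 : ℂ) * g')) • (monomial b (1 : ℂ) * g') ∈
          U G (Set.Iio ((ord n).toSyn m)) by
      simpa [h0] using h
    clear h0
    induction hf using Submodule.span_induction with
    | mem p hp =>
      obtain ⟨⟨a, g, hg, rfl⟩, hs⟩ := hp
      by_cases hc : coeff m (monomial a (1 : ℂ) * g) = 0
      · rw [hc, zero_div, zero_smul, sub_zero]
        exact Submodule.subset_span ⟨⟨a, g, hg, rfl⟩, support_lt_of_coeff_eq_zero hs hc⟩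
      · exact H a b g hg g' hg' hs hs' hc hc'
    | zero => simp
    | add x y _ _ hx hy =>
      convert Submodule.add_mem _ hx hy using 1
      rw [coeff_add, add_div, add_smul]; abel
    | smul r x _ hx =>
      convert Submodule.smul_mem _ r hx using 1
      rw [coeff_smul, smul_sub, smul_smul, smul_eq_mul, mul_div_assoc]
  · push Not at hex
    refine Submodule.span_le.2 ?_ hf
    rintro p ⟨⟨a, g, hg, rfl⟩, hs⟩
    exact Submodule.subset_span ⟨⟨a, g, hg, rfl⟩,
      support_lt_of_coeff_eq_zero hs (hex a g hg hs)⟩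

lemma U_final (G : Set (MvPolynomial (Fin n) ℂ))
    (H : ∀ m, ∀ f ∈ U G (Set.Iic ((ord n).toSyn m)), coeff m f = 0 →
      f ∈ U G (Set.Iio ((ord n).toSyn m)))
    (s : (ord n).syn) : ∀ f ∈ U G (Set.Iic s), f ≠ 0 →
      f ∈ U G (Set.Iic ((ord n).toSyn ((ord n).degree f))) := by
  induction s using WellFoundedLT.induction with
  | ind s ih =>
  intro f hf h0
  obtain ⟨m, rfl⟩ := (ord n).toSyn.surjective s
  by_cases hc : coeff m f = 0
  · rcases U_lt _ _ _ (H m f hf hc) with h | ⟨s', hs', hf'⟩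
    · exact absurd h h0
    · exact ih s' hs' f hf' h0
  · refine U_mono G (Set.Iic_subset_Iic.2 ?_) hf
    exact MonomialOrder.le_degree (mem_support_iff.2 hc)

/-- Buchberger's criterion with degree bounds. -/
lemma buch (V : ℕ → Submodule ℂ (MvPolynomial (Fin n) ℂ)) (hV : Monotone V)
    (hX : ∀ d a, ∀ p ∈ V d, monomial a (1 : ℂ) * p ∈ V (d + a.degree))
    (hdeg : ∀ d, ∀ p ∈ V d, p.totalDegree ≤ d) (d : ℕ)
    (hd : ∀ s ∈ V (3 * d), s ≠ 0 → ∃ g ∈ V d, g ≠ 0 ∧ (ord n).degree g ≤ (ord n).degree s)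
    (s : (ord n).syn) (f : MvPolynomial (Fin n) ℂ) (hf : f ∈ U (V d : Set _) (Set.Iic s)) :
    f ∈ V (d + f.totalDegree) := by
  have mono_deg : ∀ e e' : Fin n →₀ ℕ, (ord n).toSyn e ≤ (ord n).toSyn e' →
      e.degree ≤ e'.degree := fun e e' h => Finsupp.DegLex.monotone_degree h
  have supp_le : ∀ p : MvPolynomial (Fin n) ℂ, ∀ e ∈ p.support,
      (ord n).toSyn e ∈ Set.Iic ((ord n).toSyn ((ord n).degree p)) :=
    fun p e he => Set.mem_Iic.2 (MonomialOrder.le_degree he)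
  have shift_supp : ∀ (a : Fin n →₀ ℕ) (p : MvPolynomial (Fin n) ℂ),
      ∀ e ∈ (monomial a (1 : ℂ) * p).support,
        (ord n).toSyn e ∈ Set.Iic ((ord n).toSyn (a + (ord n).degree p)) := by
    intro a p e he
    obtain ⟨e', he', rfl⟩ := mem_support_monomial_mul he
    simp only [Set.mem_Iic, map_add]
    exact (add_le_add_iff_left _).2 (supp_le p e' he')
  have lin_supp : ∀ (p q : MvPolynomial (Fin n) ℂ) (c : ℂ) (Q : Set (ord n).syn),
      (∀ e ∈ p.support, (ord n).toSyn e ∈ Q) → (∀ e ∈ q.support, (ord n).toSyn e ∈ Q) →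
      ∀ e ∈ (p - c • q).support, (ord n).toSyn e ∈ Q := by
    intro p q c Q hp hq e he
    by_cases h1 : e ∈ p.support
    · exact hp e h1
    by_cases h2 : e ∈ q.support
    · exact hq e h2
    rw [notMem_support_iff] at h1 h2
    simp [h1, h2] at he
  -- reduction
  have red : ∀ s : (ord n).syn, ∀ e : Fin n →₀ ℕ, (ord n).toSyn e = s → e.degree ≤ 2 * d →
      ∀ p ∈ V (3 * d), (∀ e' ∈ p.support, (ord n).toSyn e' ∈ Set.Iic s) →
      p ∈ U (V d : Set _) (Set.Iic s) := by
    intro s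
    induction s using WellFoundedLT.induction with
    | ind s ih =>
    rintro e rfl he p hp hs
    have key : ∀ q ∈ V (3 * d), (∀ e' ∈ q.support, (ord n).toSyn e' ∈ Set.Iic ((ord n).toSyn e)) →
        coeff e q = 0 → q ∈ U (V d : Set _) (Set.Iic ((ord n).toSyn e)) := by
      intro q hq hqs h0
      by_cases hq0 : q = 0
      · rw [hq0]; exact Submodule.zero_mem _
      have hlt := support_lt_of_coeff_eq_zero hqs h0 _ (MonomialOrder.degree_mem_support (m := ord n) hq0)
      refine U_mono _ (Set.Iic_subset_Iic.2 (le_of_lt hlt))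
        (ih _ hlt _ rfl ?_ q hq (supp_le q))
      exact (mono_deg _ _ (le_of_lt hlt)).trans he
    by_cases hc : coeff e p = 0
    · exact key p hp hs hc
    have hp0 : p ≠ 0 := by rintro rfl; simp at hc
    have hpe : (ord n).degree p = e := by
      apply (ord n).toSyn.injective
      apply le_antisymm
      · exact hs _ (MonomialOrder.degree_mem_support (m := ord n) hp0)
      · exact MonomialOrder.le_degree (mem_support_iff.2 hc)
    obtain ⟨g, hg, hg0, hge⟩ := hd p hp hp0
    rw [hpe] at hge
    set a := e - (ord n).degree g with ha
    have hae : a + (ord n).degree g = e := tsub_add_cancel_of_le hge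
    have had : a.degree ≤ 2 * d := by
      have : a.degree + ((ord n).degree g).degree = e.degree := by rw [← hae, map_add]
      omega
    have hqV : monomial a (1 : ℂ) * g ∈ V (3 * d) := hV (by omega) (hX d a g hg)
    have hqs : ∀ e' ∈ (monomial a (1 : ℂ) * g).support,
        (ord n).toSyn e' ∈ Set.Iic ((ord n).toSyn e) := by
      rw [← hae]; exact shift_supp a g
    have hqc : coeff e (monomial a (1 : ℂ) * g) ≠ 0 := by
      rw [← hae, coeff_monomial_mul, one_mul]
      exact mem_support_iff.1 (MonomialOrder.degree_mem_support (m := ord n) hg0)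
    set q := monomial a (1 : ℂ) * g with hq
    have h1 := key (p - (coeff e p / coeff e q) • q)
      (Submodule.sub_mem _ hp (Submodule.smul_mem _ _ hqV)) (lin_supp _ _ _ _ hs hqs)
      (by rw [coeff_sub, coeff_smul, smul_eq_mul, div_mul_cancel₀ _ hqc, sub_self])
    have h2 : q ∈ U (V d : Set _) (Set.Iic ((ord n).toSyn e)) :=
      Submodule.subset_span ⟨⟨a, g, hg, hq⟩, hqs⟩
    have h3 := Submodule.add_mem _ h1 (Submodule.smul_mem _ (coeff e p / coeff e q) h2)
    simpa using h3
  have lead : ∀ (a m : Fin n →₀ ℕ) (g : MvPolynomial (Fin n) ℂ),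
      (∀ e ∈ (monomial a (1 : ℂ) * g).support, (ord n).toSyn e ∈ Set.Iic ((ord n).toSyn m)) →
      coeff m (monomial a (1 : ℂ) * g) ≠ 0 → g ≠ 0 ∧ a + (ord n).degree g = m := by
    intro a m g hs hc
    have hg0 : g ≠ 0 := by rintro rfl; simp at hc
    refine ⟨hg0, ?_⟩
    apply (ord n).toSyn.injective
    apply le_antisymm
    · apply hs
      rw [mem_support_iff, coeff_monomial_mul, one_mul]
      exact mem_support_iff.1 (MonomialOrder.degree_mem_support (m := ord n) hg0)
    · exact shift_supp a g m (mem_support_iff.2 hc)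
  have lowdeg : ∀ g ∈ V d, ((ord n).degree g).degree ≤ d := by
    intro g hg
    rw [MvPolynomial.degree_degLexDegree]; exact hdeg d g hg
  have step : ∀ m, ∀ f ∈ U (V d : Set _) (Set.Iic ((ord n).toSyn m)), coeff m f = 0 →
      f ∈ U (V d : Set _) (Set.Iio ((ord n).toSyn m)) := by
    intro m
    refine U_step _ m ?_
    intro a b g hg g' hg' hs hs' hc hc'
    obtain ⟨hg0, ham⟩ := lead a m g hs hc
    obtain ⟨hg0', hbm⟩ := lead b m g' hs' hc'
    set u := (ord n).degree g with hu
    set u' := (ord n).degree g' with hu'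
    set w := u ⊔ u' with hw
    have hwm : w ≤ m := sup_le (by rw [← ham]; exact le_add_self) (by rw [← hbm]; exact le_add_self)
    obtain ⟨c, hcm⟩ : ∃ c, c + w = m := ⟨m - w, tsub_add_cancel_of_le hwm⟩
    obtain ⟨v, hv⟩ : ∃ v, v + u = w := ⟨w - u, tsub_add_cancel_of_le le_sup_left⟩
    obtain ⟨v', hv'⟩ : ∃ v, v + u' = w := ⟨w - u', tsub_add_cancel_of_le le_sup_right⟩
    have hav : a = c + v := by
      apply add_right_cancel (b := u); rw [ham, add_assoc, hv, hcm]
    have hbv : b = c + v' := by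
      apply add_right_cancel (b := u'); rw [hbm, add_assoc, hv', hcm]
    have hwle : w ≤ u + u' := sup_le le_self_add le_add_self
    have hvu' : v.degree + u.degree ≤ 2 * d ∧ v.degree ≤ d ∧ v'.degree ≤ d := by
      have h1 := lowdeg g hg
      have h2 := lowdeg g' hg'
      rw [← hu] at h1
      rw [← hu'] at h2
      have h3 : w.degree ≤ u.degree + u'.degree := by
        rw [← map_add]; exact Finsupp.degree_mono hwle
      have h4 : v.degree + u.degree = w.degree := by rw [← map_add, hv]
      have h5 : v'.degree + u'.degree = w.degree := by rw [← map_add, hv']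
      omega
    have hwd : w.degree ≤ 2 * d := by rw [← hv, map_add]; exact hvu'.1
    have hcg : coeff m (monomial a (1 : ℂ) * g) = coeff w (monomial v (1 : ℂ) * g) := by
      rw [← ham, ← hv, coeff_monomial_mul, coeff_monomial_mul]
    have hcg' : coeff m (monomial b (1 : ℂ) * g') = coeff w (monomial v' (1 : ℂ) * g') := by
      rw [← hbm, ← hv', coeff_monomial_mul, coeff_monomial_mul]
    rw [hcg] at hc ⊢
    rw [hcg'] at hc' ⊢
    set r := coeff w (monomial v (1 : ℂ) * g) / coeff w (monomial v' (1 : ℂ) * g') with hr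
    set p := monomial v (1 : ℂ) * g - r • (monomial v' (1 : ℂ) * g') with hp
    have hpV : p ∈ V (3 * d) := Submodule.sub_mem _ (hV (by omega) (hX d v g hg))
      (Submodule.smul_mem _ _ (hV (by omega) (hX d v' g' hg')))
    have hps : ∀ e ∈ p.support, (ord n).toSyn e ∈ Set.Iic ((ord n).toSyn w) := by
      apply lin_supp
      · rw [← hv]; exact shift_supp v g
      · rw [← hv']; exact shift_supp v' g'
    have hpc : coeff w p = 0 := by
      rw [hp, coeff_sub, coeff_smul, smul_eq_mul, hr, div_mul_cancel₀ _ hc', sub_self]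
    have hpU : p ∈ U (V d : Set _) (Set.Iio ((ord n).toSyn w)) := by
      by_cases hp0 : p = 0
      · rw [hp0]; exact Submodule.zero_mem _
      have hlt := support_lt_of_coeff_eq_zero hps hpc _ (MonomialOrder.degree_mem_support (m := ord n) hp0)
      refine U_mono _ (Set.Iic_subset_Iio.2 hlt) (red _ _ rfl ?_ p hpV (supp_le p))
      exact (mono_deg _ _ (le_of_lt hlt)).trans hwd
    have := U_shift _ c w p hpU
    rw [hcm] at this
    convert this using 1
    rw [hp, mul_sub, mul_smul_comm, ← mul_assoc, ← mul_assoc, monomial_mul, monomial_mul, one_mul,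
      hav, hbv]
  by_cases hf0 : f = 0
  · rw [hf0]; exact Submodule.zero_mem _
  have hfin := U_final _ step s f hf hf0
  refine Submodule.span_le.2 ?_ hfin
  rintro p ⟨⟨a, g, hg, rfl⟩, hs⟩
  by_cases hg0 : g = 0
  · rw [hg0, mul_zero]; exact Submodule.zero_mem _
  refine hV ?_ (hX d a g hg)
  have h1 := hs (a + (ord n).degree g) (by
    rw [mem_support_iff, coeff_monomial_mul, one_mul]
    exact mem_support_iff.1 (MonomialOrder.degree_mem_support (m := ord n) hg0))
  have h2 := mono_deg _ _ h1
  rw [MvPolynomial.degree_degLexDegree, map_add] at h2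
  omega

/-- Elements of the ideal representable in degree at most `d`. -/
noncomputable def V {k : ℕ} (F : Fin k → MvPolynomial (Fin n) ℂ) (d : ℕ) :
    Submodule ℂ (MvPolynomial (Fin n) ℂ) where
  carrier := {f | ∃ h : Fin k → MvPolynomial (Fin n) ℂ,
    (∑ i, h i * F i) = f ∧ ∀ i, (h i * F i).totalDegree ≤ d}
  zero_mem' := ⟨0, by simp, by simp⟩
  add_mem' := by
    rintro _ _ ⟨h, rfl, hh⟩ ⟨h', rfl, hh'⟩
    refine ⟨h + h', by simp [add_mul, Finset.sum_add_distrib], fun i => ?_⟩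
    rw [Pi.add_apply, add_mul]
    exact (totalDegree_add _ _).trans (max_le (hh i) (hh' i))
  smul_mem' := by
    rintro c _ ⟨h, rfl, hh⟩
    refine ⟨c • h, by simp [Finset.smul_sum], fun i => ?_⟩
    rw [Pi.smul_apply, smul_mul_assoc]
    exact (totalDegree_smul_le _ _).trans (hh i)

lemma V_mono {k : ℕ} (F : Fin k → MvPolynomial (Fin n) ℂ) : Monotone (V F) := by
  rintro d d' h _ ⟨p, rfl, hp⟩
  exact ⟨p, rfl, fun i => (hp i).trans h⟩

lemma V_X {k : ℕ} (F : Fin k → MvPolynomial (Fin n) ℂ) (d : ℕ) (a : Fin n →₀ ℕ)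
    (p) (hp : p ∈ V F d) : monomial a (1 : ℂ) * p ∈ V F (d + a.degree) := by
  obtain ⟨h, rfl, hh⟩ := hp
  refine ⟨fun i => monomial a (1 : ℂ) * h i, by simp [Finset.mul_sum, mul_assoc], fun i => ?_⟩
  rw [mul_assoc]
  refine (totalDegree_mul _ _).trans ?_
  rw [totalDegree_monomial _ one_ne_zero, add_comm]
  exact add_le_add (hh i) le_rfl

lemma V_deg {k : ℕ} (F : Fin k → MvPolynomial (Fin n) ℂ) (d : ℕ)
    (p) (hp : p ∈ V F d) : p.totalDegree ≤ d := by
  obtain ⟨h, rfl, hh⟩ := hp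
  exact totalDegree_finsetSum_le fun i _ => hh i

lemma V_self {k : ℕ} (F : Fin k → MvPolynomial (Fin n) ℂ) (d : ℕ) (i : Fin k)
    (h : (F i).totalDegree ≤ d) : F i ∈ V F d := by
  refine ⟨Pi.single i 1, ?_, fun j => ?_⟩
  · rw [Finset.sum_eq_single i]
    · simp
    · intro j _ hj; simp [hj]
    · simp
  · by_cases hj : j = i
    · subst hj; simpa using h
    · simp [hj]

lemma ideal_U {k : ℕ} (F : Fin k → MvPolynomial (Fin n) ℂ) (G : Set (MvPolynomial (Fin n) ℂ))
    (hG : ∀ i, F i ∈ G) (f) (hf : f ∈ Ideal.span (Set.range F)) : ∃ s, f ∈ U G (Set.Iic s) := by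
  have hadd : ∀ x y, (∃ s, x ∈ U G (Set.Iic s)) → (∃ s, y ∈ U G (Set.Iic s)) →
      ∃ s, x + y ∈ U G (Set.Iic s) := by
    rintro x y ⟨s1, hx⟩ ⟨s2, hy⟩
    exact ⟨max s1 s2, Submodule.add_mem _
      (U_mono G (Set.Iic_subset_Iic.2 (le_max_left _ _)) hx)
      (U_mono G (Set.Iic_subset_Iic.2 (le_max_right _ _)) hy)⟩
  obtain ⟨c, rfl⟩ := (Ideal.mem_span_range_iff_exists_fun).1 hf
  refine Finset.sum_induction _ (fun x => ∃ s, x ∈ U G (Set.Iic s)) hadd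
    ⟨0, Submodule.zero_mem _⟩ ?_
  intro i _
  generalize c i = q
  induction q using MvPolynomial.induction_on' with
  | monomial a r =>
    refine ⟨(ord n).toSyn ((ord n).degree (monomial a (1 : ℂ) * F i)), ?_⟩
    have : monomial a r * F i = r • (monomial a (1 : ℂ) * F i) := by
      rw [← smul_mul_assoc, smul_monomial, smul_eq_mul, mul_one]
    rw [this]
    exact Submodule.smul_mem _ _ (Submodule.subset_span
      ⟨⟨a, F i, hG i, rfl⟩, fun e he => Set.mem_Iic.2 (MonomialOrder.le_degree he)⟩)
  | add p q hp hq => rw [add_mul]; exact hadd _ _ hp hq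

open Filter in
lemma part1 (n R : ℕ) : ∃ D : ℕ, ∀ (k : ℕ) (f : MvPolynomial (Fin n) ℂ)
    (F : Fin k → MvPolynomial (Fin n) ℂ), f.totalDegree ≤ R → (∀ i, (F i).totalDegree ≤ R) →
    f ∈ Ideal.span (Set.range F) → f ∈ V F D := by
  by_contra hcon
  push Not at hcon
  choose k f F hf hF hfI hfV using hcon
  set 𝒰 := hyperfilter ℕ with h𝒰
  let LM : ℕ → ℕ → (Fin n →₀ ℕ) → Prop := fun l d e =>
    ∃ s ∈ V (F l) d, s ≠ 0 ∧ (ord n).degree s = e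
  let S : ℕ → (Fin n →₀ ℕ) → Prop := fun d e => ∀ᶠ l in 𝒰, LM l d e
  have Smono : ∀ d d' e, d ≤ d' → S d e → S d' e := by
    intro d d' e hd hS
    refine Eventually.mono hS ?_
    rintro l ⟨s, hs, h⟩
    exact ⟨s, V_mono _ hd hs, h⟩
  let T : (Fin n →₀ ℕ) → Prop := fun e => ∃ d, S d e
  have hfin : {e | Minimal T e}.Finite :=
    WellQuasiOrderedLE.finite_of_isAntichain (setOfPred_minimal_antichain T)
  have hch : ∀ e : Fin n →₀ ℕ, ∃ d, Minimal T e → S d e := by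
    intro e
    by_cases h : Minimal T e
    · obtain ⟨d, hd⟩ := h.prop
      exact ⟨d, fun _ => hd⟩
    · exact ⟨0, fun h' => absurd h' h⟩
  choose δ hδ using hch
  set d := R + hfin.toFinset.sup δ with hd
  have hS : ∀ e, Minimal T e → S d e := by
    intro e he
    refine Smono (δ e) d e ?_ (hδ e he)
    have : δ e ≤ hfin.toFinset.sup δ := Finset.le_sup (hfin.mem_toFinset.2 he)
    omega
  have ev1 : ∀ᶠ l in (𝒰 : Filter ℕ), ∀ e ∈ {e | Minimal T e}, LM l d e :=
    (eventually_all_finite hfin).2 fun e he => hS e he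
  have ev2 : ∀ᶠ l in (𝒰 : Filter ℕ), ∀ e ∈ {e : Fin n →₀ ℕ | e.degree ≤ 3 * d},
      LM l (3 * d) e → S (3 * d) e := by
    refine (eventually_all_finite (Finsupp.finite_of_degree_le _)).2 fun e _ => ?_
    by_cases h : S (3 * d) e
    · exact Eventually.of_forall fun _ _ => h
    · exact (Ultrafilter.eventually_not.2 h).mono fun l hl h' => absurd h' hl
  have ev3 : ∀ᶠ l in (𝒰 : Filter ℕ), d + R ≤ l :=
    Nat.hyperfilter_le_atTop (eventually_ge_atTop _)
  obtain ⟨l, h1, h2, h3⟩ := (ev1.and (ev2.and ev3)).exists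
  apply hfV l
  obtain ⟨s, hs⟩ := ideal_U (F l) (V (F l) d : Set _)
    (fun i => V_self _ _ _ ((hF l i).trans (by omega))) (f l) (hfI l)
  refine V_mono (F l) ?_ (buch (V (F l)) (V_mono _) (V_X _) (V_deg _) d ?_ s (f l) hs)
  · have := hf l
    omega
  · intro s hs hs0
    have hT : T ((ord n).degree s) := ⟨3 * d, h2 _ (by
      simp only [Set.mem_ofPred_eq]
      rw [MvPolynomial.degree_degLexDegree]; exact V_deg _ _ _ hs) ⟨s, hs, hs0, rfl⟩⟩
    obtain ⟨e, hle, hmin⟩ := exists_minimal_le_of_wellFoundedLT T _ hT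
    obtain ⟨g, hg, hg0, rfl⟩ := h1 e hmin
    exact ⟨g, hg, hg0, hle⟩

lemma fse_rename (n : ℕ) (p : MvPolynomial (Fin n) ℂ) :
    finSuccEquiv ℂ n (rename Fin.succ p) = Polynomial.C p := by
  induction p using MvPolynomial.induction_on with
  | C a => simp [finSuccEquiv_apply]
  | add p q hp hq => simp [hp, hq]
  | mul_X p i hp => simp [hp, finSuccEquiv_X_succ]

lemma tele {A : Type*} [CommRing A] (f : A) (q : Polynomial A) (N : ℕ) :
    ∑ j ∈ Finset.range (N + 1), (q * (1 - Polynomial.C f * Polynomial.X)).coeff j * f ^ (N - j)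
      = q.coeff N := by
  have hq : q * (1 - Polynomial.C f * Polynomial.X)
      = q - Polynomial.C f * (q * Polynomial.X) := by ring
  rw [hq]
  induction N with
  | zero => simp
  | succ N ih =>
    rw [Finset.sum_range_succ]
    have : ∑ j ∈ Finset.range (N + 1),
        (q - Polynomial.C f * (q * Polynomial.X)).coeff j * f ^ (N + 1 - j) = f * q.coeff N := by
      rw [← ih, Finset.mul_sum]
      refine Finset.sum_congr rfl fun j hj => ?_
      have : N + 1 - j = (N - j) + 1 := by
        have := Finset.mem_range.1 hj
        omega
      rw [this, pow_succ]; ring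
    rw [this]
    simp

lemma deg_left {m : ℕ} {p q : MvPolynomial (Fin m) ℂ} (hq : q ≠ 0) :
    p.totalDegree ≤ (p * q).totalDegree := by
  by_cases hp : p = 0
  · simp [hp]
  · rw [totalDegree_mul_of_isDomain hp hq]; omega

lemma part2 (n R : ℕ) : ∃ D : ℕ, ∀ (k : ℕ) (f : MvPolynomial (Fin n) ℂ)
    (F : Fin k → MvPolynomial (Fin n) ℂ), f.totalDegree ≤ R → (∀ i, (F i).totalDegree ≤ R) →
    f ∈ (Ideal.span (Set.range F)).radical → ∃ m : ℕ, f ^ m ∈ V F D := by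
  obtain ⟨D, hD⟩ := part1 (n + 1) (R + 1)
  refine ⟨D + (D + 1) * R + R, fun k f F hf hF hrad => ⟨D + 1, ?_⟩⟩
  set t : MvPolynomial (Fin (n + 1)) ℂ := 1 - rename Fin.succ f * X 0 with ht
  set F' : Fin (k + 1) → MvPolynomial (Fin (n + 1)) ℂ :=
    Fin.cons t (fun i => rename Fin.succ (F i)) with hF'
  have hEt : finSuccEquiv ℂ n t = 1 - Polynomial.C f * Polynomial.X := by
    rw [ht, map_sub, map_one, map_mul, fse_rename, finSuccEquiv_X_zero]
  have ht0 : t ≠ 0 := by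
    intro h
    have h1 : (1 - Polynomial.C f * Polynomial.X : Polynomial (MvPolynomial (Fin n) ℂ)) = 0 := by
      rw [← hEt, h, map_zero]
    have := congrArg (fun p => Polynomial.coeff p 0) h1
    simp at this
  have h1 : (1 : MvPolynomial (Fin (n + 1)) ℂ) ∈ Ideal.span (Set.range F') := by
    obtain ⟨m, hm⟩ := hrad
    have hm' : (rename Fin.succ f : MvPolynomial (Fin (n + 1)) ℂ) ^ m ∈
        Ideal.span (Set.range F') := by
      rw [← map_pow]
      have h2 := Ideal.mem_map_of_mem (rename Fin.succ :
        MvPolynomial (Fin n) ℂ →ₐ[ℂ] MvPolynomial (Fin (n + 1)) ℂ) hm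
      rw [Ideal.map_span] at h2
      refine Ideal.span_mono ?_ h2
      rintro _ ⟨_, ⟨i, rfl⟩, rfl⟩
      exact ⟨i.succ, by simp [hF']⟩
    have ht' : t ∈ Ideal.span (Set.range F') := Ideal.subset_span ⟨0, by simp [hF']⟩
    have hdvd : t ∣ 1 - (rename Fin.succ f * X 0) ^ m := by
      simpa using sub_dvd_pow_sub_pow (1 : MvPolynomial (Fin (n + 1)) ℂ)
        (rename Fin.succ f * X 0) m
    have h3 := Ideal.add_mem _ (Ideal.mem_of_dvd _ hdvd ht')
      (Ideal.mul_mem_right ((X 0 : MvPolynomial (Fin (n + 1)) ℂ) ^ m) _ hm')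
    rwa [mul_pow, sub_add_cancel] at h3
  have hdegs : ∀ i, (F' i).totalDegree ≤ R + 1 := by
    intro i
    refine Fin.cases ?_ (fun i => ?_) i
    · simp only [hF', Fin.cons_zero, ht]
      refine (totalDegree_sub _ _).trans (max_le (by simp) ?_)
      refine (totalDegree_mul _ _).trans (add_le_add ((totalDegree_rename_le _ _).trans hf) ?_)
      simp
    · simp only [hF', Fin.cons_succ]
      exact (totalDegree_rename_le _ _).trans ((hF i).trans (by omega))
  obtain ⟨h, hsum, hh⟩ := hD (k + 1) 1 F' (by simp) hdegs h1
  rw [Fin.sum_univ_succ] at hsum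
  simp only [hF', Fin.cons_zero, Fin.cons_succ] at hsum
  have hE := congrArg (finSuccEquiv ℂ n) hsum
  simp only [map_add, map_mul, map_sum, hEt, map_one, fse_rename] at hE
  set N := D + 1 with hN
  have hq0 : (finSuccEquiv ℂ n (h 0)).coeff N = 0 := by
    by_contra hne
    have a1 := totalDegree_coeff_finSuccEquiv_add_le (h 0) N hne
    have a2 := hh 0
    simp only [hF', Fin.cons_zero] at a2
    have a3 := deg_left (p := h 0) ht0
    omega
  have hsumN := congrArg (fun p : Polynomial (MvPolynomial (Fin n) ℂ) =>
    ∑ j ∈ Finset.range (N + 1), p.coeff j * f ^ (N - j)) hE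
  simp only [Polynomial.coeff_add, add_mul, Finset.sum_add_distrib, tele, hq0, zero_add,
    Polynomial.finsetSum_coeff, Polynomial.coeff_mul_C] at hsumN
  refine ⟨fun i => ∑ j ∈ Finset.range (N + 1),
    (finSuccEquiv ℂ n (h i.succ)).coeff j * f ^ (N - j), ?_, ?_⟩
  · have hr : ∑ j ∈ Finset.range (N + 1),
        (1 : Polynomial (MvPolynomial (Fin n) ℂ)).coeff j * f ^ (N - j) = f ^ N := by
      rw [Finset.sum_eq_single 0]
      · simp
      · intro j _ hj; simp [Polynomial.coeff_one, hj]
      · simp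
    rw [← hr, ← hsumN]
    simp only [Finset.sum_mul]
    rw [Finset.sum_comm]
    refine Finset.sum_congr rfl fun j _ => Finset.sum_congr rfl fun i _ => ?_
    ring
  · intro i
    by_cases hFi : F i = 0
    · simp [hFi]
    have hFi' : rename Fin.succ (F i) ≠ 0 := by
      intro h0
      exact hFi (rename_injective _ (Fin.succ_injective n) (by rw [h0, map_zero]))
    have a2 := hh i.succ
    simp only [hF', Fin.cons_succ] at a2
    have a3 := deg_left (p := h i.succ) hFi'
    refine (totalDegree_mul _ _).trans (add_le_add ?_ (hF i))
    refine totalDegree_finsetSum_le fun j hj => ?_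
    refine (totalDegree_mul _ _).trans (add_le_add ?_ ?_)
    · by_cases hc : (finSuccEquiv ℂ n (h i.succ)).coeff j = 0
      · simp [hc]
      · have a1 := totalDegree_coeff_finSuccEquiv_add_le (h i.succ) j hc
        omega
    · refine (totalDegree_pow _ _).trans ?_
      exact Nat.mul_le_mul (Nat.sub_le _ _) hf

end EffNull



/-- **Effective Nullstellensatz (Hermann + Rabinowitsch).** For every `n ∈ ℕ₊` there is an
increasing function `K : ℕ → ℕ` such that for all polynomials `f, f₁, …, f_k ∈ ℂ[X₁,…,Xₙ]`
of degree at most `R`, with `𝔞` the ideal generated by the `fᵢ`: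
(1) if `f ∈ 𝔞` then `f = Σ hᵢ fᵢ` with `deg(hᵢfᵢ) ≤ K(R)`;
(2) if `f ∈ rad 𝔞` then `f^m = Σ gᵢ fᵢ` for some `m ∈ ℕ`, with `deg(gᵢfᵢ) ≤ K(R)`. -/
theorem effective_nullstellensatz (n : ℕ) (hn : 0 < n) :
    ∃ K : ℕ → ℕ, Monotone K ∧
      ∀ (R k : ℕ) (f : MvPolynomial (Fin n) ℂ) (F : Fin k → MvPolynomial (Fin n) ℂ),
        f.totalDegree ≤ R → (∀ i, (F i).totalDegree ≤ R) →
        ((f ∈ Ideal.span (Set.range F) →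
            ∃ h : Fin k → MvPolynomial (Fin n) ℂ,
              (∑ i, h i * F i) = f ∧ ∀ i, (h i * F i).totalDegree ≤ K R) ∧
         (f ∈ (Ideal.span (Set.range F)).radical →
            ∃ (m : ℕ) (g : Fin k → MvPolynomial (Fin n) ℂ),
              (∑ i, g i * F i) = f ^ m ∧ ∀ i, (g i * F i).totalDegree ≤ K R)) := by

  choose D1 hD1 using EffNull.part1 n
  choose D2 hD2 using EffNull.part2 n
  refine ⟨fun R => ∑ r ∈ Finset.range (R + 1), (D1 r + D2 r), ?_, ?_⟩
  · intro a b hab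
    exact Finset.sum_le_sum_of_subset (Finset.range_mono (by omega))
  · intro R k f F hf hF
    have hK : D1 R + D2 R ≤ ∑ r ∈ Finset.range (R + 1), (D1 r + D2 r) :=
      Finset.single_le_sum (f := fun r => D1 r + D2 r) (fun _ _ => Nat.zero_le _)
        (Finset.mem_range.2 (Nat.lt_succ_self R))
    refine ⟨fun h => ?_, fun h => ?_⟩
    · exact EffNull.V_mono F (le_trans (by omega) hK) (hD1 R k f F hf hF h)
    · obtain ⟨m, hm⟩ := hD2 R k f F hf hF h
      exact ⟨m, EffNull.V_mono F (le_trans (by omega) hK) hm⟩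
end
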